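/- arXiv:2106.11590 — 2 statements merged into one kernel-verified Lean document; each statement's English description precedes it below -/
import Mathlib

section
/- Let d be a positive odd squarefree integer, n ≥ 1 odd, and p an odd prime with p ∣ d. Let R = ℤ[√-d]/(p) with σ the ring endomorphism induced by conjugation, and let L = diag(1,…,1,-1) of size n+1. Then the number N of matrices A ∈ M_{n+1}(R) with A·L·σ(A)ᵀ = L and det A = 1 satisfies, as rational numbers, N = p^{(n+1)²-1} · (1 - ε·p^{-(n+1)/2}) · ∏_{i=1}^{(n-1)/2} (1 - p^{-2i}), where ε = ((-1)^{(n+3)/2}/p) is the Legendre symbol of (-1)^{(n+3)/2} modulo p. -/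
open Matrix

/-- The quotient ring `ℤ[√-d]/(m)`. -/
abbrev Rq (d m : ℤ) : Type := Zsqrtd (-d) ⧸ Ideal.span {(m : Zsqrtd (-d))}

/-- Conjugation `a + b√-d ↦ a - b√-d` descends to the quotient `ℤ[√-d]/(m)`. -/
noncomputable def conjQ (d m : ℤ) : Rq d m →+* Rq d m :=
  Ideal.quotientMap (Ideal.span {(m : Zsqrtd (-d))}) (starRingEnd (Zsqrtd (-d)))
    (by
      rw [Ideal.span_singleton_le_iff_mem, Ideal.mem_comap, map_intCast]
      exact Ideal.mem_span_singleton_self _)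

/-- The diagonal matrix `diag(1, …, 1, -1)` of size `n+1`. -/
def Lmat (R : Type*) [Ring R] (n : ℕ) : Matrix (Fin (n + 1)) (Fin (n + 1)) R :=
  Matrix.diagonal fun i => if i = Fin.last n then -1 else 1

section Counting
variable {F : Type*} [Field F] [Fintype F] [DecidableEq F]

/-- Summing a function over squares. -/
lemma sum_comp_sq (hF : ringChar F ≠ 2) (f : F → ℤ) :
    ∑ y : F, f (y ^ 2) = ∑ u : F, (quadraticChar F u + 1) * f u := by
  rw [Finset.sum_comp f (fun y : F => y ^ 2)]
  rw [Finset.sum_subset (Finset.subset_univ _)]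
  · refine Finset.sum_congr rfl fun u _ => ?_
    rw [← quadraticChar_card_sqrts hF u, nsmul_eq_mul]
    congr 3
    ext; simp
  · intro u _ hu
    rw [Finset.card_eq_zero.2, zero_smul]
    rw [Finset.filter_eq_empty_iff]
    intro x _ hx
    exact hu (Finset.mem_image.2 ⟨x, Finset.mem_univ _, hx⟩)

lemma sum_quadraticChar_mul_sub (hF : ringChar F ≠ 2) (b t : F) :
    ∑ u : F, quadraticChar F u * quadraticChar F (t - b * u) =
      quadraticChar F (-b) * ((if t = 0 then (Fintype.card F : ℤ) else 0) - 1) := by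
  have key : ∑ u : F, quadraticChar F u * quadraticChar F (t - b * u) =
      ∑ w ∈ Finset.univ.erase (0 : F), quadraticChar F (t * w - b) := by
    rw [← Finset.add_sum_erase _ _ (Finset.mem_univ (0 : F)), quadraticChar_zero, zero_mul,
      zero_add]
    refine Finset.sum_nbij' (fun u => u⁻¹) (fun u => u⁻¹) (by simp) (by simp) (by simp) (by simp) ?_
    intro u hu
    have hu0 : u ≠ 0 := by simpa using hu
    have h1 : t - b * u = u * (t * u⁻¹ - b) := by field_simp
    rw [h1, map_mul, ← mul_assoc, ← sq, quadraticChar_sq_one hu0, one_mul]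
  rw [key]
  split_ifs with ht
  · subst ht
    simp [Finset.card_erase_of_mem]
    rw [Nat.cast_sub Fintype.card_pos]
    push_cast
    ring
  · have h2 : ∑ w : F, quadraticChar F (t * w - b) = 0 := by
      rw [← quadraticChar_sum_zero hF]
      exact Fintype.sum_equiv ((Equiv.mulLeft₀ t ht).trans (Equiv.subRight b)) _ _ (by simp)
    rw [← Finset.add_sum_erase _ _ (Finset.mem_univ (0 : F))] at h2
    simp only [mul_zero, zero_sub] at h2
    linarith

lemma card_binary_form (hF : ringChar F ≠ 2) {b : F} (hb : b ≠ 0) (t : F) :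
    (Nat.card {z : F × F // z.1 ^ 2 + b * z.2 ^ 2 = t} : ℤ) =
      Fintype.card F - quadraticChar F (-b) +
        quadraticChar F (-b) * Fintype.card F * (if t = 0 then 1 else 0) := by
  have h1 : (Nat.card {z : F × F // z.1 ^ 2 + b * z.2 ^ 2 = t} : ℤ) =
      ∑ y : F, (quadraticChar F (t - b * y ^ 2) + 1) := by
    have e : {z : F × F // z.1 ^ 2 + b * z.2 ^ 2 = t} ≃
        Σ y : F, {x : F // x ^ 2 = t - b * y ^ 2} :=
      { toFun := fun z => ⟨z.1.2, z.1.1, by linear_combination z.2⟩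
        invFun := fun s => ⟨(s.2.1, s.1), by linear_combination s.2.2⟩
        left_inv := fun _ => rfl
        right_inv := fun _ => rfl }
    rw [Nat.card_congr e, Nat.card_sigma, Nat.cast_sum]
    refine Finset.sum_congr rfl fun y _ => ?_
    rw [← quadraticChar_card_sqrts hF, Set.toFinset_card, Nat.card_eq_fintype_card]
    congr 1
  rw [h1, sum_comp_sq hF fun u => quadraticChar F (t - b * u) + 1]
  have h2 : ∑ w : F, quadraticChar F (t - b * w) = 0 := by
    rw [← quadraticChar_sum_zero hF]
    exact Fintype.sum_equiv ((Equiv.mulLeft₀ b hb).trans (Equiv.subLeft t)) _ _ (by simp)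
  have h3 : ∀ u : F, (quadraticChar F u + 1) * (quadraticChar F (t - b * u) + 1) =
      quadraticChar F u * quadraticChar F (t - b * u) + quadraticChar F u +
        quadraticChar F (t - b * u) + 1 := fun u => by ring
  simp only [h3, Finset.sum_add_distrib, h2, quadraticChar_sum_zero hF,
    sum_quadraticChar_mul_sub hF]
  simp only [Finset.sum_const, Finset.card_univ, nsmul_eq_mul, mul_one]
  split_ifs <;> ring

/-- Splitting off a binary form `x² + b y²` from a diagonal quadric. -/
lemma card_diagonal_quadric (hF : ringChar F ≠ 2) {k : ℕ} (a : Fin (k + 2) → F)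
    (h0 : a 0 = 1) (h1 : a 1 ≠ 0) (c : F) :
    (Nat.card {v : Fin (k + 2) → F // ∑ i, a i * v i ^ 2 = c} : ℤ) =
      (Fintype.card F : ℤ) ^ k * (Fintype.card F - quadraticChar F (-a 1)) +
        quadraticChar F (-a 1) * Fintype.card F *
          Nat.card {u : Fin k → F // ∑ i, a i.succ.succ * u i ^ 2 = c} := by
  have e : {v : Fin (k + 2) → F // ∑ i, a i * v i ^ 2 = c} ≃
      Σ u : Fin k → F, {z : F × F // z.1 ^ 2 + a 1 * z.2 ^ 2 =
        c - ∑ i, a i.succ.succ * u i ^ 2} :=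
    { toFun := fun v => ⟨fun i => v.1 i.succ.succ, (v.1 0, v.1 1), by
        have := v.2
        rw [Fin.sum_univ_succ, Fin.sum_univ_succ, h0] at this
        simp only [Fin.succ_zero_eq_one] at this
        linear_combination this⟩
      invFun := fun s => ⟨Fin.cons s.2.1.1 (Fin.cons s.2.1.2 s.1), by
        have := s.2.2
        rw [Fin.sum_univ_succ, Fin.sum_univ_succ, h0]
        simp only [Fin.cons_zero, Fin.cons_succ]
        simp only [Fin.succ_zero_eq_one]
        linear_combination this⟩
      left_inv := fun v => by
        ext i
        refine Fin.cases rfl (fun i => Fin.cases rfl (fun i => rfl) i) i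
      right_inv := fun s => rfl }
  rw [Nat.card_congr e, Nat.card_sigma, Nat.cast_sum]
  simp only [card_binary_form hF h1, Finset.sum_add_distrib, ← Finset.mul_sum]
  congr 1
  · simp only [Finset.sum_const, Finset.card_univ, nsmul_eq_mul, Fintype.card_fun,
      Fintype.card_fin, Nat.cast_pow]
  · congr 1
    rw [Nat.card_eq_fintype_card, Fintype.card_subtype, Finset.sum_boole]
    congr 2
    ext u
    simp only [Finset.mem_filter, Finset.mem_univ, true_and]
    rw [sub_eq_zero, eq_comm]

end Counting
lemma orthogonal_mul {ι R : Type*} [Fintype ι] [CommRing R] {D A G : Matrix ι ι R}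
    (hA : A * D * Aᵀ = D) (hG : G * D * Gᵀ = D) :
    (A * G) * D * (A * G)ᵀ = D := by
  calc (A * G) * D * (A * G)ᵀ = A * (G * D * Gᵀ) * Aᵀ := by
        simp only [transpose_mul, Matrix.mul_assoc]
    _ = D := by rw [hG, hA]

section Orthogonal
variable {ι F : Type*} [Fintype ι] [DecidableEq ι] [Field F]

lemma mul_diagonal_mul_transpose_eq_iff (a : ι → F) (A : Matrix ι ι F) :
    A * diagonal a * Aᵀ = diagonal a ↔
      ∀ i j, ∑ k, A i k * a k * A j k = if i = j then a i else 0 := by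
  rw [← Matrix.ext_iff]
  simp [Matrix.mul_apply, diagonal_apply]

/-- The matrix of the reflection along `w` for the diagonal form with coefficients `a`, acting on
row vectors. -/
def reflectionMatrix (a w : ι → F) : Matrix ι ι F :=
  1 - (2 / ∑ i, a i * w i ^ 2) • vecMulVec (a * w) w

lemma reflectionMatrix_mul_self (a w : ι → F) (hw : ∑ i, a i * w i ^ 2 ≠ 0) :
    reflectionMatrix a w * reflectionMatrix a w = 1 := by
  have h : w ⬝ᵥ (a * w) = ∑ i, a i * w i ^ 2 :=
    Finset.sum_congr rfl fun i _ => by simp only [Pi.mul_apply]; ring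
  simp only [reflectionMatrix, mul_sub, sub_mul, one_mul, mul_one, smul_mul_smul_comm,
    vecMulVec_mul_vecMulVec, h, vecMulVec_smul, smul_smul]
  rw [mul_assoc, div_mul_cancel₀ _ hw, mul_two, add_smul]
  abel

lemma reflectionMatrix_orthogonal (a w : ι → F) (hw : ∑ i, a i * w i ^ 2 ≠ 0) :
    reflectionMatrix a w * diagonal a * (reflectionMatrix a w)ᵀ = diagonal a := by
  have h : reflectionMatrix a w * diagonal a = diagonal a * (reflectionMatrix a w)ᵀ := by
    ext i j
    simp [reflectionMatrix, Matrix.mul_diagonal, Matrix.diagonal_mul, vecMulVec_apply,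
      Matrix.one_apply]
    by_cases hij : i = j
    · subst hij; simp; ring
    · simp [hij]; ring
  rw [h, Matrix.mul_assoc, ← transpose_mul, reflectionMatrix_mul_self a w hw, transpose_one,
    Matrix.mul_one]

/-- The orthogonal group of a diagonal form acts transitively on vectors of the same nonzero
length as a basis vector, by involutions. -/
lemma exists_orthogonal_involution_row_eq (h2 : (2 : F) ≠ 0) (a : ι → F) (i₀ : ι)
    (ha : a i₀ ≠ 0) (v : ι → F) (hv : ∑ i, a i * v i ^ 2 = a i₀) :
    ∃ G : Matrix ι ι F, G * diagonal a * Gᵀ = diagonal a ∧ G * G = 1 ∧ G i₀ = v := by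
  obtain ⟨w, hw⟩ : ∃ w : F → ι → F, ∀ s i, w s i = (if i₀ = i then 1 else 0) - s * v i :=
    ⟨_, fun _ _ => rfl⟩
  have hQ : ∀ s : F, ∑ i, a i * w s i ^ 2 = a i₀ - 2 * s * (a i₀ * v i₀) + s ^ 2 * a i₀ := by
    intro s
    have : ∀ i, a i * w s i ^ 2 =
        (if i₀ = i then a i - 2 * s * (a i * v i) else 0) + s ^ 2 * (a i * v i ^ 2) := by
      intro i
      rw [hw]
      split_ifs <;> ring
    rw [Finset.sum_congr rfl fun i _ => this i, Finset.sum_add_distrib, ← Finset.mul_sum, hv]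
    simp
  have hrow : ∀ s : F, s ^ 2 = 1 → ∑ i, a i * w s i ^ 2 ≠ 0 →
      ∀ j, reflectionMatrix a (w s) i₀ j = s * v j := by
    intro s hs hne j
    have h1 : (2 / ∑ i, a i * w s i ^ 2) * (a i₀ * w s i₀) = 1 := by
      rw [div_mul_eq_mul_div, div_eq_one_iff_eq hne, hQ, hw, if_pos rfl]
      linear_combination -a i₀ * hs
    simp only [reflectionMatrix, Matrix.sub_apply, Matrix.smul_apply, vecMulVec_apply,
      Pi.mul_apply, smul_eq_mul, Matrix.one_apply]
    rw [← mul_assoc, h1, hw]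
    ring
  by_cases h : ∑ i, a i * w 1 i ^ 2 = 0
  · have h' : ∑ i, a i * w (-1) i ^ 2 ≠ 0 := by
      rw [hQ] at h ⊢
      intro h3
      have : (2 : F) * 2 * a i₀ = 0 := by linear_combination h + h3
      simp [h2, ha] at this
    refine ⟨-reflectionMatrix a (w (-1)), ?_, ?_, ?_⟩
    · simpa using reflectionMatrix_orthogonal a _ h'
    · simpa using reflectionMatrix_mul_self a _ h'
    · ext j
      simp [hrow (-1) (by norm_num) h']
  · refine ⟨_, reflectionMatrix_orthogonal a _ h, reflectionMatrix_mul_self a _ h, ?_⟩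
    ext j
    simp [hrow 1 (by norm_num) h]

/-- Orbit-stabilizer for the orthogonal group of a diagonal form acting on a sphere. -/
lemma card_orthogonal_eq_mul_card_row_eq [Fintype F] [DecidableEq F] (h2 : (2 : F) ≠ 0)
    (a : ι → F) (i₀ : ι) (ha : a i₀ ≠ 0) :
    Nat.card {A : Matrix ι ι F // A * diagonal a * Aᵀ = diagonal a} =
      Nat.card {v : ι → F // ∑ i, a i * v i ^ 2 = a i₀} *
        Nat.card {A : Matrix ι ι F // A * diagonal a * Aᵀ = diagonal a ∧
          A i₀ = Pi.single i₀ 1} := by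
  choose G hG hGG hGrow using fun v : {v : ι → F // ∑ i, a i * v i ^ 2 = a i₀} =>
    exists_orthogonal_involution_row_eq h2 a i₀ ha v.1 v.2
  have hsphere : ∀ A : Matrix ι ι F, A * diagonal a * Aᵀ = diagonal a →
      ∑ i, a i * A i₀ i ^ 2 = a i₀ := by
    intro A hA
    have := (mul_diagonal_mul_transpose_eq_iff a A).1 hA i₀ i₀
    rw [if_pos rfl] at this
    rw [← this]
    exact Finset.sum_congr rfl fun i _ => by ring
  rw [← Nat.card_prod]
  refine Nat.card_congr
    { toFun := fun A => ⟨⟨A.1 i₀, hsphere A.1 A.2⟩,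
        ⟨A.1 * G ⟨A.1 i₀, hsphere A.1 A.2⟩, orthogonal_mul A.2 (hG _), ?_⟩⟩
      invFun := fun x => ⟨x.2.1 * G x.1, orthogonal_mul x.2.2.1 (hG _)⟩
      left_inv := ?_
      right_inv := ?_ }
  · have h1 : ∀ v, v.1 = A.1 i₀ → (A.1 * G v) i₀ = Pi.single i₀ 1 := by
      intro v hv
      have : (A.1 * G v) i₀ = (G v * G v) i₀ := by
        ext j
        simp only [Matrix.mul_apply, hGrow v, hv]
      rw [this, hGG]
      ext j
      simp [Matrix.one_apply, Pi.single_apply, eq_comm]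
    exact h1 _ rfl
  · intro A
    simp [Matrix.mul_assoc, hGG]
  · rintro ⟨v, A, hA, hrow⟩
    have h1 : (A * G v) i₀ = v.1 := by
      rw [← hGrow v]
      ext j
      simp [Matrix.mul_apply, hrow, Pi.single_apply]
    have h2 : ∀ h, (⟨(A * G v) i₀, h⟩ : {v : ι → F // ∑ i, a i * v i ^ 2 = a i₀}) = v :=
      fun h => Subtype.ext h1
    simp [h2, Matrix.mul_assoc, hGG]

end Orthogonal

lemma card_orthogonal_row_zero_eq {F : Type*} [Field F] {m : ℕ} (a : Fin (m + 1) → F)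
    (ha : a 0 ≠ 0) :
    Nat.card {A : Matrix (Fin (m + 1)) (Fin (m + 1)) F // A * diagonal a * Aᵀ = diagonal a ∧
        A 0 = Pi.single 0 1} =
      Nat.card {B : Matrix (Fin m) (Fin m) F //
        B * diagonal (fun i => a i.succ) * Bᵀ = diagonal fun i => a i.succ} := by
  have hcol : ∀ A : Matrix (Fin (m + 1)) (Fin (m + 1)) F, A * diagonal a * Aᵀ = diagonal a →
      A 0 = Pi.single 0 1 → ∀ i : Fin m, A i.succ 0 = 0 := by
    intro A hA h0 i
    have := (mul_diagonal_mul_transpose_eq_iff a A).1 hA i.succ 0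
    simpa [Fin.sum_univ_succ, h0, ha] using this
  refine Nat.card_congr
    { toFun := fun A => ⟨A.1.submatrix Fin.succ Fin.succ, ?_⟩
      invFun := fun B => ⟨Matrix.of (Fin.cons (Pi.single 0 1) fun i => Fin.cons 0 (B.1 i)), ?_, ?_⟩
      left_inv := ?_
      right_inv := ?_ }
  · rw [mul_diagonal_mul_transpose_eq_iff]
    intro i j
    have := (mul_diagonal_mul_transpose_eq_iff a A.1).1 A.2.1 i.succ j.succ
    simpa [Fin.sum_univ_succ, hcol A.1 A.2.1 A.2.2] using this
  · have hB := (mul_diagonal_mul_transpose_eq_iff _ B.1).1 B.2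
    rw [mul_diagonal_mul_transpose_eq_iff]
    intro i j
    refine Fin.cases ?_ (fun i => ?_) i <;> refine Fin.cases ?_ (fun j => ?_) j
    · simp [Fin.sum_univ_succ]
    · simp [Fin.sum_univ_succ, (Fin.succ_ne_zero _).symm]
    · simp [Fin.sum_univ_succ]
    · simpa [Fin.sum_univ_succ] using hB i j
  · rfl
  · rintro ⟨A, hA, h0⟩
    ext i j
    refine Fin.cases ?_ (fun i => ?_) i
    · simp [h0]
    · refine Fin.cases ?_ (fun j => ?_) j
      · simp [hcol A hA h0]
      · simp
  · intro B
    ext i j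
    simp

/-- The order of the orthogonal group of a diagonal form is the size of a sphere times the order
of the orthogonal group of the form with one coefficient removed. -/
lemma card_orthogonal_succ {F : Type*} [Field F] [Fintype F] [DecidableEq F] (h2 : (2 : F) ≠ 0)
    {m : ℕ} (a : Fin (m + 1) → F) (ha : a 0 ≠ 0) :
    Nat.card {A : Matrix (Fin (m + 1)) (Fin (m + 1)) F // A * diagonal a * Aᵀ = diagonal a} =
      Nat.card {v : Fin (m + 1) → F // ∑ i, a i * v i ^ 2 = a 0} *
        Nat.card {B : Matrix (Fin m) (Fin m) F //
          B * diagonal (fun i => a i.succ) * Bᵀ = diagonal fun i => a i.succ} := by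
  rw [card_orthogonal_eq_mul_card_row_eq h2 a 0 ha, card_orthogonal_row_zero_eq a ha]

/-- The coefficients `1, …, 1, -1` of the diagonal form `Lmat`. -/
def lorentzCoeff (F : Type*) [Ring F] (n : ℕ) (i : Fin (n + 1)) : F :=
  if i = Fin.last n then -1 else 1

section LorentzianForm
variable {F : Type*} [Field F]

lemma lorentzCoeff_succ (n : ℕ) (i : Fin (n + 1)) :
    lorentzCoeff F (n + 1) i.succ = lorentzCoeff F n i := by
  simp only [lorentzCoeff, ← Fin.succ_last, Fin.succ_inj]

lemma lorentzCoeff_zero (n : ℕ) : lorentzCoeff F (n + 1) 0 = 1 := by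
  simp [lorentzCoeff, Fin.ext_iff]

lemma lorentzCoeff_one (n : ℕ) : lorentzCoeff F (n + 2) 1 = 1 := by
  rw [← Fin.succ_zero_eq_one, lorentzCoeff_succ, lorentzCoeff_zero]

variable [Fintype F] [DecidableEq F]

lemma card_lorentz_sphere_add_two (hF : ringChar F ≠ 2) (n : ℕ) :
    (Nat.card {v : Fin (n + 3) → F // ∑ i, lorentzCoeff F (n + 2) i * v i ^ 2 = 1} : ℤ) =
      (Fintype.card F : ℤ) ^ (n + 1) * (Fintype.card F - quadraticChar F (-1)) +
        quadraticChar F (-1) * Fintype.card F *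
          Nat.card {v : Fin (n + 1) → F // ∑ i, lorentzCoeff F n i * v i ^ 2 = 1} := by
  have := card_diagonal_quadric hF (lorentzCoeff F (n + 2)) (lorentzCoeff_zero _)
    (by simp [lorentzCoeff_one]) 1
  simpa only [lorentzCoeff_succ, lorentzCoeff_one] using this

lemma card_lorentz_sphere_even (hF : ringChar F ≠ 2) (j : ℕ) :
    (Nat.card {v : Fin (2 * j + 1) → F // ∑ i, lorentzCoeff F (2 * j) i * v i ^ 2 = 1} : ℤ) =
      (Fintype.card F : ℤ) ^ (2 * j) +
        quadraticChar F (-1) ^ (j + 1) * (Fintype.card F : ℤ) ^ j := by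
  induction j with
  | zero =>
    have e : {v : Fin (2 * 0 + 1) → F // ∑ i, lorentzCoeff F (2 * 0) i * v i ^ 2 = 1} ≃
        {x : F // x ^ 2 = -1} :=
      (Equiv.funUnique (Fin 1) F).subtypeEquiv fun v => by
        simp [lorentzCoeff, neg_eq_iff_eq_neg]
    have h := quadraticChar_card_sqrts hF (-1)
    rw [Set.toFinset_card] at h
    rw [Nat.card_congr e, Nat.card_eq_fintype_card]
    simp only [mul_zero, pow_zero, zero_add, pow_one, mul_one]
    rw [add_comm, ← h]
    congr 1
  | succ j ih =>
    have := card_lorentz_sphere_add_two hF (2 * j)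
    rw [ih] at this
    exact this.trans (by ring)

lemma card_lorentz_sphere_odd (hF : ringChar F ≠ 2) (j : ℕ) :
    (Nat.card {v : Fin (2 * j + 1 + 1) → F //
      ∑ i, lorentzCoeff F (2 * j + 1) i * v i ^ 2 = 1} : ℤ) =
      (Fintype.card F : ℤ) ^ (2 * j + 1) -
        quadraticChar F (-1) ^ j * (Fintype.card F : ℤ) ^ j := by
  induction j with
  | zero =>
    have h1 : lorentzCoeff F 1 1 = -1 := by simp [lorentzCoeff]
    have := card_diagonal_quadric hF (k := 0) (lorentzCoeff F 1) (lorentzCoeff_zero _)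
      (by simp [h1]) 1
    rw [h1, neg_neg, map_one] at this
    simpa using this
  | succ j ih =>
    have := card_lorentz_sphere_add_two hF (2 * j + 1)
    rw [ih] at this
    exact this.trans (by ring)

lemma card_lorentz_orthogonal_succ (hF : ringChar F ≠ 2) (n : ℕ) :
    Nat.card {A : Matrix (Fin (n + 2)) (Fin (n + 2)) F //
        A * diagonal (lorentzCoeff F (n + 1)) * Aᵀ = diagonal (lorentzCoeff F (n + 1))} =
      Nat.card {v : Fin (n + 2) → F // ∑ i, lorentzCoeff F (n + 1) i * v i ^ 2 = 1} *
      Nat.card {A : Matrix (Fin (n + 1)) (Fin (n + 1)) F //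
        A * diagonal (lorentzCoeff F n) * Aᵀ = diagonal (lorentzCoeff F n)} := by
  have := card_orthogonal_succ (Ring.two_ne_zero hF) (lorentzCoeff F (n + 1))
    (by simp [lorentzCoeff_zero])
  simpa only [lorentzCoeff_succ, lorentzCoeff_zero] using this

lemma card_lorentz_orthogonal_zero (hF : ringChar F ≠ 2) :
    Nat.card {A : Matrix (Fin 1) (Fin 1) F //
        A * diagonal (lorentzCoeff F 0) * Aᵀ = diagonal (lorentzCoeff F 0)} = 2 := by
  have e : {A : Matrix (Fin 1) (Fin 1) F //
        A * diagonal (lorentzCoeff F 0) * Aᵀ = diagonal (lorentzCoeff F 0)} ≃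
      {x : F // x ^ 2 = 1} :=
    Equiv.subtypeEquiv
      { toFun := fun A => A 0 0
        invFun := fun x => Matrix.of fun _ _ => x
        left_inv := fun A => by ext i j; fin_cases i; fin_cases j; rfl
        right_inv := fun x => rfl }
      fun A => by
        rw [mul_diagonal_mul_transpose_eq_iff]
        change _ ↔ A 0 0 ^ 2 = 1
        simp [lorentzCoeff, sq]
  have h := quadraticChar_card_sqrts hF 1
  rw [Set.toFinset_card, map_one] at h
  rw [Nat.card_congr e, Nat.card_eq_fintype_card]
  zify
  exact (congrArg _ (Fintype.card_congr (Equiv.refl _))).trans h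

/-- The order of the orthogonal group of `x₁² + ⋯ + xₙ² - xₙ₊₁²` in an even number of variables. -/
lemma card_lorentz_orthogonal (hF : ringChar F ≠ 2) (j : ℕ) :
    (Nat.card {A : Matrix (Fin (2 * j + 1 + 1)) (Fin (2 * j + 1 + 1)) F //
        A * diagonal (lorentzCoeff F (2 * j + 1)) * Aᵀ =
          diagonal (lorentzCoeff F (2 * j + 1))} : ℤ) =
      2 * ((Fintype.card F : ℤ) ^ (j + 1) - quadraticChar F (-1) ^ j) *
        (Fintype.card F : ℤ) ^ (j * (j + 1)) *
        ∏ i ∈ Finset.Icc 1 j, ((Fintype.card F : ℤ) ^ (2 * i) - 1) := by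
  induction j with
  | zero =>
    have h := card_lorentz_sphere_odd hF 0
    rw [card_lorentz_orthogonal_succ hF, Nat.cast_mul, h, mul_zero,
      card_lorentz_orthogonal_zero hF]
    simp
    ring
  | succ j ih =>
    have hχ : quadraticChar F (-1) ^ 2 = 1 := quadraticChar_sq_one (by simp)
    have h1 := card_lorentz_sphere_odd hF (j + 1)
    have h2 := card_lorentz_sphere_even hF (j + 1)
    have h3 := card_lorentz_orthogonal_succ hF (2 * j + 1 + 1)
    rw [card_lorentz_orthogonal_succ hF (2 * j + 1)] at h3
    zify at h3
    refine h3.trans ?_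
    rw [ih, Finset.prod_Icc_succ_top (by omega)]
    refine (congrArg₂ (· * ·) h1 (congrArg (· * _) h2)).trans ?_
    have h4 : (quadraticChar F (-1) ^ j) ^ 2 = 1 := by rw [← pow_mul, mul_comm, pow_mul, hχ, one_pow]
    have h5 : quadraticChar F (-1) ^ (j + 1 + 1) = quadraticChar F (-1) ^ j := by
      rw [add_assoc, pow_add, hχ, mul_one]
    rw [h5]
    generalize quadraticChar F (-1) ^ (j + 1) = y
    generalize quadraticChar F (-1) ^ j = x at *
    generalize ∏ i ∈ Finset.Icc 1 j, ((Fintype.card F : ℤ) ^ (2 * i) - 1) = P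
    generalize (Fintype.card F : ℤ) = q
    have h6 : q ^ (2 * (j + 1)) - 1 = (q ^ (j + 1) - x) * (q ^ (j + 1) + x) := by
      linear_combination h4
    rw [h6]
    ring

end LorentzianForm

/-- The special orthogonal group of a nondegenerate diagonal form has index two. -/
lemma card_orthogonal_eq_two_mul {ι F : Type*} [Fintype ι] [DecidableEq ι] [Field F] [Fintype F]
    (h2 : (2 : F) ≠ 0) (a : ι → F) (ha : ∀ i, a i ≠ 0) (i₀ : ι) :
    Nat.card {A : Matrix ι ι F // A * diagonal a * Aᵀ = diagonal a} =
      2 * Nat.card {A : Matrix ι ι F // A * diagonal a * Aᵀ = diagonal a ∧ A.det = 1} := by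
  obtain ⟨G, hG, hGG, hdet⟩ : ∃ G : Matrix ι ι F,
      G * diagonal a * Gᵀ = diagonal a ∧ G * G = 1 ∧ G.det = -1 := by
    refine ⟨diagonal (Function.update 1 i₀ (-1)), ?_, ?_, ?_⟩
    · rw [diagonal_transpose, diagonal_mul_diagonal, diagonal_mul_diagonal]
      congr 1
      ext i
      by_cases h : i = i₀ <;> simp [h]
    · rw [diagonal_mul_diagonal, ← diagonal_one]
      congr 1
      ext i
      by_cases h : i = i₀ <;> simp [h]
    · rw [det_diagonal, Finset.prod_update_of_mem (Finset.mem_univ _)]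
      simp
  have hdet_sq : ∀ A : Matrix ι ι F, A * diagonal a * Aᵀ = diagonal a → A.det = 1 ∨ A.det = -1 := by
    intro A hA
    have h := congrArg det hA
    rw [det_mul, det_mul, det_transpose, mul_right_comm, det_diagonal] at h
    rw [← mul_self_eq_one_iff]
    exact mul_right_cancel₀ (Finset.prod_ne_zero_iff.2 fun i _ => ha i) (h.trans (one_mul _).symm)
  have hne : (-1 : F) ≠ 1 := fun h => h2 (by linear_combination -h)
  classical
  have e1 : {A : Matrix ι ι F // A * diagonal a * Aᵀ = diagonal a ∧ ¬ A.det = 1} ≃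
      {A : Matrix ι ι F // A * diagonal a * Aᵀ = diagonal a ∧ A.det = 1} :=
    { toFun := fun A => ⟨A.1 * G, orthogonal_mul A.2.1 hG, by
        rw [det_mul, hdet, (hdet_sq A.1 A.2.1).resolve_left A.2.2]; ring⟩
      invFun := fun A => ⟨A.1 * G, orthogonal_mul A.2.1 hG, by
        rw [det_mul, hdet, A.2.2, one_mul]; exact hne⟩
      left_inv := fun A => by simp [Matrix.mul_assoc, hGG]
      right_inv := fun A => by simp [Matrix.mul_assoc, hGG] }
  have e2 := (Equiv.sumCompl (fun A : {A : Matrix ι ι F // A * diagonal a * Aᵀ = diagonal a} =>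
    A.1.det = 1)).symm.trans (Equiv.sumCongr
      (Equiv.subtypeSubtypeEquivSubtypeInter _ fun A : Matrix ι ι F => A.det = 1)
      ((Equiv.subtypeSubtypeEquivSubtypeInter _ fun A : Matrix ι ι F => ¬ A.det = 1).trans e1))
  rw [Nat.card_congr e2, Nat.card_sum, two_mul]

section DualNumber
open DualNumber

/-- The involution `x + yε ↦ x - yε` of the dual numbers. -/
def dualConj {F : Type*} [CommRing F] (z : F[ε]) : F[ε] :=
  TrivSqZeroExt.inl z.fst - TrivSqZeroExt.inr z.snd

lemma dualNumber_matrix_ext {ι F : Type*} {P Q : Matrix ι ι F[ε]}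
    (h1 : P.map TrivSqZeroExt.fst = Q.map TrivSqZeroExt.fst)
    (h2 : P.map TrivSqZeroExt.snd = Q.map TrivSqZeroExt.snd) : P = Q := by
  ext i j
  · exact congrFun (congrFun h1 i) j
  · exact congrFun (congrFun h2 i) j

variable {ι F : Type*} [Fintype ι] [CommRing F]

lemma map_fst_mul (P Q : Matrix ι ι F[ε]) :
    (P * Q).map TrivSqZeroExt.fst = P.map TrivSqZeroExt.fst * Q.map TrivSqZeroExt.fst := by
  ext i j
  simp [Matrix.mul_apply, TrivSqZeroExt.fst_sum]

lemma map_snd_mul (P Q : Matrix ι ι F[ε]) :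
    (P * Q).map TrivSqZeroExt.snd =
      P.map TrivSqZeroExt.fst * Q.map TrivSqZeroExt.snd +
        P.map TrivSqZeroExt.snd * Q.map TrivSqZeroExt.fst := by
  ext i j
  simp [Matrix.mul_apply, TrivSqZeroExt.snd_sum, Finset.sum_add_distrib, mul_comm]

variable [DecidableEq ι]

/-- The determinant of a matrix over the dual numbers, in terms of its two components. -/
lemma det_dualNumber_eq_one_iff (A : Matrix ι ι F[ε]) (X : Matrix ι ι F)
    (hX : A.map TrivSqZeroExt.snd = X * A.map TrivSqZeroExt.fst) :
    A.det = 1 ↔ (A.map TrivSqZeroExt.fst).det = 1 ∧ X.trace = 0 := by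
  set B := A.map TrivSqZeroExt.fst with hB
  have hA : A = (1 + (ε : F[ε]) • X.map TrivSqZeroExt.inl) * B.map TrivSqZeroExt.inl := by
    apply dualNumber_matrix_ext
    · rw [map_fst_mul]
      ext i j
      simp [Matrix.mul_apply, Matrix.one_apply, hB, apply_ite]
    · rw [map_snd_mul, hX]
      ext i j
      simp [Matrix.mul_apply, Matrix.one_apply, hB, apply_ite]
  have hdet : A.det = TrivSqZeroExt.inl B.det + TrivSqZeroExt.inr (X.trace * B.det) := by
    have h1 : (B.map TrivSqZeroExt.inl).det = (TrivSqZeroExt.inl B.det : F[ε]) :=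
      ((TrivSqZeroExt.inlHom F F).map_det B).symm
    have h2 : (X.map TrivSqZeroExt.inl).trace = (TrivSqZeroExt.inl X.trace : F[ε]) :=
      (AddMonoidHom.map_trace (TrivSqZeroExt.inlHom F F) X).symm
    rw [hA, det_mul, det_one_add_smul, h1, h2, pow_two, DualNumber.eps_mul_eps]
    ext <;> simp
  rw [hdet, TrivSqZeroExt.ext_iff]
  simp only [TrivSqZeroExt.fst_add, TrivSqZeroExt.fst_inl, TrivSqZeroExt.fst_inr, add_zero,
    TrivSqZeroExt.fst_one, TrivSqZeroExt.snd_add, TrivSqZeroExt.snd_inl, TrivSqZeroExt.snd_inr,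
    zero_add, TrivSqZeroExt.snd_one]
  exact and_congr_right fun h => by rw [h, mul_one]

/-- The special unitary group over the dual numbers fibres over the special orthogonal group, with
fibre the symmetric matrices in the kernel of a trace. -/
noncomputable def dualUnitaryEquiv (D : Matrix ι ι F) (hD : Dᵀ = D) (hDD : D * D = 1) :
    {A : Matrix ι ι F[ε] // A * D.map TrivSqZeroExt.inl * (A.map dualConj)ᵀ =
        D.map TrivSqZeroExt.inl ∧ A.det = 1} ≃
      {B : Matrix ι ι F // B * D * Bᵀ = D ∧ B.det = 1} ×
        {S : Matrix ι ι F // Sᵀ = S ∧ (S * D).trace = 0} := by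
  have hinv : ∀ B : Matrix ι ι F, B * D * Bᵀ = D → D * Bᵀ * (D * B) = 1 := by
    intro B hB
    have : B * (D * Bᵀ * D) = 1 := by rw [← hDD, ← Matrix.mul_assoc, ← Matrix.mul_assoc, hB]
    have := mul_eq_one_comm.1 this
    rwa [Matrix.mul_assoc] at this
  have hunitary : ∀ A : Matrix ι ι F[ε],
      A * D.map TrivSqZeroExt.inl * (A.map dualConj)ᵀ = D.map TrivSqZeroExt.inl ↔
      A.map TrivSqZeroExt.fst * D * (A.map TrivSqZeroExt.fst)ᵀ = D ∧
      (A.map TrivSqZeroExt.snd * D * (A.map TrivSqZeroExt.fst)ᵀ)ᵀ =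
        A.map TrivSqZeroExt.snd * D * (A.map TrivSqZeroExt.fst)ᵀ := by
    intro A
    have h1 : (D.map (TrivSqZeroExt.inl : F → F[ε])).map TrivSqZeroExt.fst = D := by ext; simp
    have h2 : (D.map (TrivSqZeroExt.inl : F → F[ε])).map TrivSqZeroExt.snd = 0 := by ext; simp
    have h3 : (A.map dualConj)ᵀ.map TrivSqZeroExt.fst = (A.map TrivSqZeroExt.fst)ᵀ := by
      ext; simp [dualConj]
    have h4 : (A.map dualConj)ᵀ.map TrivSqZeroExt.snd = -(A.map TrivSqZeroExt.snd)ᵀ := by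
      ext; simp [dualConj]
    have h5 : (A * D.map TrivSqZeroExt.inl * (A.map dualConj)ᵀ).map TrivSqZeroExt.fst =
        A.map TrivSqZeroExt.fst * D * (A.map TrivSqZeroExt.fst)ᵀ := by
      rw [map_fst_mul, map_fst_mul, h1, h3]
    have h6 : (A * D.map TrivSqZeroExt.inl * (A.map dualConj)ᵀ).map TrivSqZeroExt.snd =
        A.map TrivSqZeroExt.fst * D * -(A.map TrivSqZeroExt.snd)ᵀ +
          A.map TrivSqZeroExt.snd * D * (A.map TrivSqZeroExt.fst)ᵀ := by
      rw [map_snd_mul, map_fst_mul, map_snd_mul, h1, h2, h3, h4, Matrix.mul_zero, zero_add]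
    rw [transpose_mul, transpose_mul, transpose_transpose, hD, ← Matrix.mul_assoc]
    constructor
    · intro h
      rw [h, h1] at h5
      rw [h, h2, Matrix.mul_neg, eq_comm, neg_add_eq_zero] at h6
      exact ⟨h5.symm, h6⟩
    · rintro ⟨h7, h8⟩
      apply dualNumber_matrix_ext
      · rw [h5, h1, h7]
      · rw [h6, h2, Matrix.mul_neg, h8, neg_add_cancel]
  have hdet : ∀ A : Matrix ι ι F[ε],
      A.map TrivSqZeroExt.fst * D * (A.map TrivSqZeroExt.fst)ᵀ = D → (A.det = 1 ↔
      (A.map TrivSqZeroExt.fst).det = 1 ∧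
        (A.map TrivSqZeroExt.snd * D * (A.map TrivSqZeroExt.fst)ᵀ * D).trace = 0) := by
    intro A hA
    apply det_dualNumber_eq_one_iff
    have := hinv _ hA
    rw [Matrix.mul_assoc, Matrix.mul_assoc, Matrix.mul_assoc, ← Matrix.mul_assoc D, this,
      Matrix.mul_one]
  exact
    { toFun := fun A => ⟨⟨A.1.map TrivSqZeroExt.fst, ((hunitary _).1 A.2.1).1,
          ((hdet _ ((hunitary _).1 A.2.1).1).1 A.2.2).1⟩,
        ⟨A.1.map TrivSqZeroExt.snd * D * (A.1.map TrivSqZeroExt.fst)ᵀ,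
          ((hunitary _).1 A.2.1).2, ((hdet _ ((hunitary _).1 A.2.1).1).1 A.2.2).2⟩⟩
      invFun := fun x => by
        have h1 : (x.1.1.map TrivSqZeroExt.inl +
            (x.2.1 * (D * x.1.1)).map TrivSqZeroExt.inr : Matrix ι ι F[ε]).map
              TrivSqZeroExt.fst = x.1.1 := by ext; simp
        have h2 : (x.1.1.map TrivSqZeroExt.inl +
            (x.2.1 * (D * x.1.1)).map TrivSqZeroExt.inr : Matrix ι ι F[ε]).map
              TrivSqZeroExt.snd = x.2.1 * (D * x.1.1) := by ext; simp
        have h3 : x.2.1 * (D * x.1.1) * D * x.1.1ᵀ = x.2.1 := by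
          have := x.1.2.1
          rw [Matrix.mul_assoc, Matrix.mul_assoc, Matrix.mul_assoc, ← Matrix.mul_assoc x.1.1, this,
            hDD, Matrix.mul_one]
        refine ⟨x.1.1.map TrivSqZeroExt.inl + (x.2.1 * (D * x.1.1)).map TrivSqZeroExt.inr,
          (hunitary _).2 ?_, (hdet _ ?_).2 ?_⟩
        · rw [h1, h2, h3]
          exact ⟨x.1.2.1, x.2.2.1⟩
        · rw [h1]
          exact x.1.2.1
        · rw [h1, h2, h3]
          exact ⟨x.1.2.2, x.2.2.2⟩
      left_inv := by
        intro A
        have := hinv _ ((hunitary _).1 A.2.1).1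
        apply Subtype.ext
        dsimp only
        rw [Matrix.mul_assoc (A.1.map TrivSqZeroExt.snd), Matrix.mul_assoc, this, Matrix.mul_one]
        ext <;> simp
      right_inv := by
        rintro ⟨⟨B, hB⟩, ⟨S, hS⟩⟩
        have h1 : (B.map TrivSqZeroExt.inl +
            (S * (D * B)).map TrivSqZeroExt.inr : Matrix ι ι F[ε]).map
              TrivSqZeroExt.fst = B := by ext; simp
        have h2 : (B.map TrivSqZeroExt.inl +
            (S * (D * B)).map TrivSqZeroExt.inr : Matrix ι ι F[ε]).map
              TrivSqZeroExt.snd = S * (D * B) := by ext; simp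
        have h3 : S * (D * B) * D * Bᵀ = S := by
          rw [Matrix.mul_assoc, Matrix.mul_assoc, Matrix.mul_assoc, ← Matrix.mul_assoc B, hB.1,
            hDD, Matrix.mul_one]
        simp only [h1, h2, h3] }

end DualNumber

/-- The number of symmetric matrices in a hyperplane cut out by a weighted trace. -/
lemma card_symm_trace_eq_zero {ι F : Type*} [Fintype ι] [DecidableEq ι] [Field F] [Fintype F]
    (a : ι → F) (i₀ : ι) (ha : a i₀ ≠ 0) :
    Fintype.card F * Nat.card {S : Matrix ι ι F // Sᵀ = S ∧ (S * diagonal a).trace = 0} =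
      Fintype.card F ^ (Fintype.card ι + 1).choose 2 := by
  have htr : ∀ t : F, (Matrix.single i₀ i₀ t * diagonal a).trace = t * a i₀ := fun t => by
    simp [Matrix.trace, Matrix.single_apply]
  have e1 : F × {S : Matrix ι ι F // Sᵀ = S ∧ (S * diagonal a).trace = 0} ≃
      {S : Matrix ι ι F // Sᵀ = S} :=
    { toFun := fun x => ⟨x.2.1 + Matrix.single i₀ i₀ x.1, by
        rw [transpose_add, x.2.2.1, transpose_single]⟩
      invFun := fun S => ⟨(S.1 * diagonal a).trace / a i₀,
        S.1 - Matrix.single i₀ i₀ ((S.1 * diagonal a).trace / a i₀), by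
          rw [transpose_sub, S.2, transpose_single], by
          rw [sub_mul, trace_sub, htr, div_mul_cancel₀ _ ha, sub_self]⟩
      left_inv := fun x => by
        have : ((x.2.1 + Matrix.single i₀ i₀ x.1) * diagonal a).trace / a i₀ = x.1 := by
          rw [add_mul, trace_add, x.2.2.2, zero_add, htr,
            mul_div_cancel_right₀ _ ha]
        simp [this]
      right_inv := fun S => by simp }
  have e2 : {S : Matrix ι ι F // Sᵀ = S} ≃ (Sym2 ι → F) :=
    (Equiv.subtypeEquivRight fun S => by
      rw [← Matrix.ext_iff]
      exact ⟨fun h i j => h j i, fun h i j => h j i⟩).trans (Sym2.lift (α := ι) (β := F))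
  rw [← Nat.card_eq_fintype_card (α := F), ← Nat.card_prod, Nat.card_congr (e1.trans e2),
    Nat.card_fun, ← Sym2.card, Nat.card_eq_fintype_card (α := Sym2 ι)]

section RamifiedQuotient
open DualNumber

/-- Reduction `a + b√-d ↦ a + bε` at a prime dividing `d`. -/
noncomputable def zsqrtdToDual (d : ℤ) (p : ℕ) (hpd : (p : ℤ) ∣ d) :
    Zsqrtd (-d) →+* (ZMod p)[ε] :=
  Zsqrtd.lift ⟨ε, by
    have h : (d : ZMod p) = 0 := (ZMod.intCast_zmod_eq_zero_iff_dvd d p).2 hpd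
    rw [DualNumber.eps_mul_eps, ← TrivSqZeroExt.inl_intCast, Int.cast_neg, h, neg_zero,
      TrivSqZeroExt.inl_zero]⟩

lemma zsqrtdToDual_fst (d : ℤ) (p : ℕ) (hpd : (p : ℤ) ∣ d) (z : Zsqrtd (-d)) :
    (zsqrtdToDual d p hpd z).fst = z.re := by
  simp [zsqrtdToDual]

lemma zsqrtdToDual_snd (d : ℤ) (p : ℕ) (hpd : (p : ℤ) ∣ d) (z : Zsqrtd (-d)) :
    (zsqrtdToDual d p hpd z).snd = z.im := by
  simp [zsqrtdToDual]

lemma zsqrtdToDual_surjective (d : ℤ) (p : ℕ) (hpd : (p : ℤ) ∣ d) :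
    Function.Surjective (zsqrtdToDual d p hpd) := by
  intro x
  obtain ⟨a, ha⟩ := ZMod.intCast_surjective x.fst
  obtain ⟨b, hb⟩ := ZMod.intCast_surjective x.snd
  refine ⟨⟨a, b⟩, ?_⟩
  ext
  · rw [zsqrtdToDual_fst, ha]
  · rw [zsqrtdToDual_snd, hb]

lemma ker_zsqrtdToDual (d : ℤ) (p : ℕ) (hpd : (p : ℤ) ∣ d) :
    Ideal.span {((p : ℤ) : Zsqrtd (-d))} = RingHom.ker (zsqrtdToDual d p hpd) := by
  ext z
  rw [Ideal.mem_span_singleton, Zsqrtd.intCast_dvd, RingHom.mem_ker, TrivSqZeroExt.ext_iff,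
    zsqrtdToDual_fst, zsqrtdToDual_snd, TrivSqZeroExt.fst_zero, TrivSqZeroExt.snd_zero,
    ZMod.intCast_zmod_eq_zero_iff_dvd, ZMod.intCast_zmod_eq_zero_iff_dvd]

/-- At a ramified prime `p`, the ring `ℤ[√-d]/(p)` is the ring of dual numbers over `𝔽_p`. -/
noncomputable def rqEquivDual (d : ℤ) (p : ℕ) (hpd : (p : ℤ) ∣ d) :
    Rq d p ≃+* (ZMod p)[ε] :=
  (Ideal.quotEquivOfEq (ker_zsqrtdToDual d p hpd)).trans
    (RingHom.quotientKerEquivOfSurjective (zsqrtdToDual_surjective d p hpd))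

lemma rqEquivDual_mk (d : ℤ) (p : ℕ) (hpd : (p : ℤ) ∣ d) (z : Zsqrtd (-d)) :
    rqEquivDual d p hpd (Ideal.Quotient.mk _ z) = zsqrtdToDual d p hpd z :=
  rfl

lemma rqEquivDual_conjQ (d : ℤ) (p : ℕ) (hpd : (p : ℤ) ∣ d) (x : Rq d p) :
    rqEquivDual d p hpd (conjQ d p x) = dualConj (rqEquivDual d p hpd x) := by
  obtain ⟨z, rfl⟩ := Ideal.Quotient.mk_surjective x
  rw [conjQ, Ideal.quotientMap_mk, rqEquivDual_mk, rqEquivDual_mk]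
  rw [starRingEnd_apply]
  ext <;> simp [dualConj, zsqrtdToDual_fst, zsqrtdToDual_snd]

lemma card_unitary_Rq_eq (d : ℤ) (p : ℕ) (hpd : (p : ℤ) ∣ d) (n : ℕ) :
    Nat.card {A : Matrix (Fin (n + 1)) (Fin (n + 1)) (Rq d p) //
        A * Lmat (Rq d p) n * (A.map (conjQ d p))ᵀ = Lmat (Rq d p) n ∧ A.det = 1} =
      Nat.card {A : Matrix (Fin (n + 1)) (Fin (n + 1)) (ZMod p)[ε] //
        A * (diagonal (lorentzCoeff (ZMod p) n)).map TrivSqZeroExt.inl * (A.map dualConj)ᵀ =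
          (diagonal (lorentzCoeff (ZMod p) n)).map TrivSqZeroExt.inl ∧ A.det = 1} := by
  set φ := rqEquivDual d p hpd
  have hL : φ.mapMatrix (Lmat (Rq d p) n) =
      (diagonal (lorentzCoeff (ZMod p) n)).map TrivSqZeroExt.inl := by
    ext i j : 1
    by_cases h : i = j
    · subst h
      simp only [RingEquiv.mapMatrix_apply, Matrix.map_apply, Lmat, lorentzCoeff,
        diagonal_apply_eq]
      split_ifs <;> simp
    · simp [Lmat, h]
  have hconj : ∀ A : Matrix (Fin (n + 1)) (Fin (n + 1)) (Rq d p),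
      φ.mapMatrix (A.map (conjQ d p))ᵀ = ((φ.mapMatrix A).map dualConj)ᵀ := by
    intro A
    ext i j : 1
    exact rqEquivDual_conjQ d p hpd (A j i)
  refine Nat.card_congr (φ.mapMatrix.toEquiv.subtypeEquiv fun A => ?_)
  refine and_congr ?_ ?_
  · rw [← φ.mapMatrix.injective.eq_iff, map_mul, map_mul, hL, hconj]
    rfl
  · rw [← φ.injective.eq_iff, map_one, RingEquiv.map_det]
    rfl

end RamifiedQuotient

lemma prod_pow_two_mul_sub_one {K : Type*} [Field K] {q : K} (hq : q ≠ 0) (j : ℕ) :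
    ∏ i ∈ Finset.Icc 1 j, (q ^ (2 * i) - 1) =
      q ^ (j * (j + 1)) * ∏ i ∈ Finset.Icc 1 j, (1 - q ^ (-(2 * (i : ℤ)))) := by
  induction j with
  | zero => simp
  | succ j ih =>
    rw [Finset.prod_Icc_succ_top (by omega), Finset.prod_Icc_succ_top (by omega), ih]
    have h : q ^ (2 * (j + 1)) * q ^ (-(2 * ((j + 1 : ℕ) : ℤ))) = 1 := by
      rw [_root_.zpow_neg, show (2 * ((j + 1 : ℕ) : ℤ)) = ((2 * (j + 1) : ℕ) : ℤ) by push_cast; ring,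
        zpow_natCast]
      exact mul_inv_cancel₀ (pow_ne_zero _ hq)
    linear_combination
      (q ^ (j * (j + 1)) * ∏ i ∈ Finset.Icc 1 j, (1 - q ^ (-(2 * (i : ℤ))))) * h

/-- For `n` odd and an odd ramified prime `p ∣ d`, the order of `SU(L, ℤ[√-d]/(p))`
equals `p^{(n+1)²-1} · (1 - ε·p^{-(n+1)/2}) · ∏_{i=1}^{(n-1)/2} (1 - p^{-2i})`, where
`ε = ((-1)^{(n+3)/2} / p)` is a Legendre symbol. -/
theorem card_SU_L_mod_p_ramified_odd (d : ℤ) (hd : 0 < d) (hodd : Odd d)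
    (hsf : Squarefree d) (n : ℕ) (hn : 1 ≤ n) (hnodd : Odd n)
    (p : ℕ) [Fact p.Prime] (hp2 : p ≠ 2) (hpd : (p : ℤ) ∣ d) :
    (Nat.card {A : Matrix (Fin (n + 1)) (Fin (n + 1)) (Rq d p) //
        A * Lmat (Rq d p) n * (A.map (conjQ d p))ᵀ = Lmat (Rq d p) n ∧
        A.det = 1} : ℚ)
      = (p : ℚ) ^ ((n + 1) ^ 2 - 1) *
        (1 - (legendreSym p ((-1) ^ ((n + 3) / 2)) : ℚ) * (p : ℚ) ^ (-(((n + 1) / 2 : ℕ) : ℤ))) *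
        ∏ i ∈ Finset.Icc 1 ((n - 1) / 2), (1 - (p : ℚ) ^ (-(2 * (i : ℤ)))) := by
  obtain ⟨j, rfl⟩ := hnodd
  have hF : ringChar (ZMod p) ≠ 2 := by rwa [ZMod.ringChar_zmod_n]
  have h2 := Ring.two_ne_zero hF
  have hp0 : (p : ℚ) ≠ 0 := Nat.cast_ne_zero.2 (Fact.out : p.Prime).ne_zero
  have ha : ∀ i, lorentzCoeff (ZMod p) (2 * j + 1) i ≠ 0 := fun i => by
    unfold lorentzCoeff
    split_ifs <;> simp
  have hDD : diagonal (lorentzCoeff (ZMod p) (2 * j + 1)) *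
      diagonal (lorentzCoeff (ZMod p) (2 * j + 1)) = 1 := by
    rw [diagonal_mul_diagonal, ← diagonal_one]
    congr 1
    ext i
    unfold lorentzCoeff
    split_ifs <;> simp
  have hχ : legendreSym p ((-1) ^ ((2 * j + 1 + 3) / 2)) = quadraticChar (ZMod p) (-1) ^ j := by
    rw [show (2 * j + 1 + 3) / 2 = j + 2 by omega, legendreSym]
    push_cast
    rw [map_pow, pow_add, quadraticChar_sq_one (by simp), mul_one]
  have hO := card_lorentz_orthogonal hF j
  rw [card_orthogonal_eq_two_mul h2 _ ha 0, ZMod.card] at hO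
  have hS := card_symm_trace_eq_zero _ 0 (ha 0)
  rw [ZMod.card, Fintype.card_fin, Nat.choose_two_right,
    show (2 * j + 1 + 1 + 1) * (2 * j + 1 + 1 + 1 - 1) / 2 = (2 * j + 3) * (j + 1) by
      rw [show (2 * j + 1 + 1 + 1) * (2 * j + 1 + 1 + 1 - 1) = (2 * j + 3) * (j + 1) * 2 by
        rw [Nat.add_sub_cancel]; ring]
      simp] at hS
  rw [card_unitary_Rq_eq d p hpd, Nat.card_congr (dualUnitaryEquiv _ (diagonal_transpose _) hDD),
    Nat.card_prod, hχ, show (2 * j + 1 - 1) / 2 = j by omega,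
    show (2 * j + 1 + 1) / 2 = j + 1 by omega]
  generalize Nat.card {B : Matrix (Fin (2 * j + 1 + 1)) (Fin (2 * j + 1 + 1)) (ZMod p) //
    B * diagonal (lorentzCoeff (ZMod p) (2 * j + 1)) * Bᵀ =
      diagonal (lorentzCoeff (ZMod p) (2 * j + 1)) ∧ B.det = 1} = N at *
  generalize Nat.card {S : Matrix (Fin (2 * j + 1 + 1)) (Fin (2 * j + 1 + 1)) (ZMod p) //
    Sᵀ = S ∧ (S * diagonal (lorentzCoeff (ZMod p) (2 * j + 1))).trace = 0} = M at *
  replace hO := congrArg (Int.cast : ℤ → ℚ) hO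
  replace hS := congrArg (Nat.cast : ℕ → ℚ) hS
  push_cast at hO hS ⊢
  rw [prod_pow_two_mul_sub_one hp0] at hO
  generalize ∏ i ∈ Finset.Icc 1 j, (1 - (p : ℚ) ^ (-(2 * (i : ℤ)))) = P at *
  generalize ((quadraticChar (ZMod p) (-1) : ℤ) : ℚ) ^ j = x at *
  have hx : (p : ℚ) ^ (j + 1) - x = (p : ℚ) ^ (j + 1) * (1 - x * (p : ℚ) ^ (-((j : ℤ) + 1))) := by
    have : (p : ℚ) ^ (j + 1) * (p : ℚ) ^ (-((j : ℤ) + 1)) = 1 := by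
      rw [_root_.zpow_neg, ← Nat.cast_succ, zpow_natCast]
      exact mul_inv_cancel₀ (pow_ne_zero _ hp0)
    linear_combination x * this
  rw [hx] at hO
  generalize 1 - x * (p : ℚ) ^ (-((j : ℤ) + 1)) = y at *
  have hexp : (p : ℚ) * (p : ℚ) ^ ((2 * j + 1 + 1) ^ 2 - 1) =
      (p : ℚ) ^ ((2 * j + 3) * (j + 1)) * (p : ℚ) ^ (j + 1) * (p : ℚ) ^ (j * (j + 1)) *
        (p : ℚ) ^ (j * (j + 1)) := by
    rw [← pow_succ', Nat.sub_add_cancel (Nat.one_le_pow _ _ (by omega))]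
    ring
  have hN : (N : ℚ) = (p : ℚ) ^ (j + 1) * y * (p : ℚ) ^ (j * (j + 1)) *
      ((p : ℚ) ^ (j * (j + 1)) * P) := by linear_combination hO / 2
  refine mul_left_cancel₀ hp0 ?_
  calc (p : ℚ) * (N * M) = N * (p * M) := by ring
    _ = _ := by
      rw [hS, hN]
      linear_combination -(y * P) * hexp
end

section
/- Let d be a positive squarefree integer with d ≡ 1 (mod 4) and n ≥ 1. Let R = ℤ[√-d]/(8) with σ the ring endomorphism induced by conjugation, and let L = diag(1,…,1,-1) of size n+1. Then the number N of matrices A ∈ M_{n+1}(R) with A·L·σ(A)ᵀ = L and det A = 1 satisfies, as rational numbers, N = 2^{3(n+1)²-3} · ∏_{i=1}^{⌊n/2⌋} (1 - 2^{-2i}). -/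
open Matrix

/-- `H = A K A*` for some `A`, where `A*` is the conjugate transpose with respect to `σ`. -/
def IsRepresentedBy {R ι κ : Type*} [CommRing R] [Fintype κ] (σ : R →+* R)
    (H : Matrix ι ι R) (K : Matrix κ κ R) : Prop :=
  ∃ A : Matrix ι κ R, A * K * (A.map σ)ᵀ = H

namespace IsRepresentedBy

variable {R : Type*} [CommRing R] {σ : R →+* R}
  {ι κ μ ι' κ' : Type*} [Fintype μ] [Fintype κ']

theorem trans [Fintype κ] {H : Matrix ι ι R} {K : Matrix κ κ R} {M : Matrix μ μ R}
    (h₁ : IsRepresentedBy σ H K) (h₂ : IsRepresentedBy σ K M) : IsRepresentedBy σ H M := by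
  obtain ⟨A, rfl⟩ := h₁
  obtain ⟨B, rfl⟩ := h₂
  exact ⟨A * B, by simp [Matrix.map_mul, transpose_mul, Matrix.mul_assoc]⟩

protected theorem refl [Fintype ι] [DecidableEq ι] (H : Matrix ι ι R) : IsRepresentedBy σ H H :=
  ⟨1, by simp [Matrix.map_one]⟩

theorem fromBlocks [Fintype κ] {C : Matrix ι ι R} {C' : Matrix κ κ R} {D : Matrix ι' ι' R}
    {D' : Matrix κ' κ' R} (h₁ : IsRepresentedBy σ C C') (h₂ : IsRepresentedBy σ D D') :
    IsRepresentedBy σ (fromBlocks C 0 0 D) (Matrix.fromBlocks C' 0 0 D') := by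
  obtain ⟨A, rfl⟩ := h₁
  obtain ⟨B, rfl⟩ := h₂
  refine ⟨Matrix.fromBlocks A 0 0 B, ?_⟩
  simp [fromBlocks_multiply, fromBlocks_map, fromBlocks_transpose]

theorem submatrix_left [Fintype ι] [DecidableEq ι] (H : Matrix ι ι R) (e : κ ≃ ι) :
    IsRepresentedBy σ (H.submatrix e e) H := by
  refine ⟨(1 : Matrix ι ι R).submatrix e id, ?_⟩
  have h : ((1 : Matrix ι ι R).submatrix e id).map σ = (1 : Matrix ι ι R).submatrix e id := by
    ext i j
    simp [Matrix.one_apply, apply_ite σ]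
  rw [h, transpose_submatrix, transpose_one]
  ext i j
  simp [Matrix.mul_apply, Matrix.one_apply]

theorem submatrix_right [Fintype κ] [DecidableEq κ] [Fintype ι] (H : Matrix ι ι R) (e : κ ≃ ι) :
    IsRepresentedBy σ H (H.submatrix e e) := by
  simpa using submatrix_left (σ := σ) (H.submatrix e e) e.symm

/-- Splitting off a unit diagonal entry by the Schur complement. -/
theorem schur [Fintype ι] [DecidableEq ι] {a a' : R} (ha : a * a' = 1) (ha' : σ a' = a')
    (b : Matrix Unit ι R) (hb : (b.map σ).map σ = b) (D : Matrix ι ι R) :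
    IsRepresentedBy σ
      (Matrix.fromBlocks (a • (1 : Matrix Unit Unit R)) b (b.map σ)ᵀ D)
      (Matrix.fromBlocks (a • (1 : Matrix Unit Unit R)) 0 0 (D - a' • ((b.map σ)ᵀ * b))) := by
  refine ⟨Matrix.fromBlocks 1 0 (a' • (b.map σ)ᵀ) 1, ?_⟩
  have h : ((a' • (b.map σ)ᵀ).map σ)ᵀ = a' • b := by
    ext i j
    have := congrFun (congrFun hb i) j
    simp_all
  rw [fromBlocks_map, fromBlocks_transpose, h]
  simp [fromBlocks_multiply, Matrix.map_one, smul_smul, ha, mul_comm a' a]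

theorem scalar_of_norm {a b u : R} (h : a = u * σ u * b) :
    IsRepresentedBy σ (a • (1 : Matrix Unit Unit R)) (b • (1 : Matrix Unit Unit R)) :=
  ⟨u • 1, by ext; simp [h]; ring⟩

end IsRepresentedBy

/-- The properties of conjugation `σ` and of the residue map `ρ` on `ℤ[√-d]/(8)`, `d ≡ 1 mod 4`,
on which the count of the special unitary group depends. -/
structure RamifiedConj {R : Type*} [CommRing R] (σ : R →+* R) (ρ : R →+* ZMod 2) : Prop where
  conj_conj : ∀ r, σ (σ r) = r
  residue_conj : ∀ r, ρ (σ r) = ρ r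
  norm_mem : ∀ r, r * σ r ∈ (Int.castRingHom R).range
  norm_odd : ∀ r, ρ r = 1 → r * σ r = 1 ∨ r * σ r = 5
  eight : (8 : R) = 0
  four_ne : (4 : R) ≠ 0
  card_fiber : ∀ z, Nat.card {r // ρ r = z} = 32
  card_norm_one : Nat.card {r // r * σ r = 1} = 16
  exists_norm_five : ∃ u, u * σ u = 5
  exists_norm_add : ∃ x y, x * σ x + y * σ y = -1

/-- Hermitian matrices with integral diagonal that reduce to the identity over the residue
field. -/
structure IsUnitHermitian {R ι : Type*} [CommRing R] [DecidableEq ι] (σ : R →+* R)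
    (ρ : R →+* ZMod 2) (H : Matrix ι ι R) : Prop where
  diag : ∀ i, H i i ∈ (Int.castRingHom R).range
  conj : ∀ i j, σ (H i j) = H j i
  residue : ∀ i j, ρ (H i j) = (1 : Matrix ι ι (ZMod 2)) i j

namespace RamifiedConj

variable {R : Type*} [CommRing R] {σ : R →+* R} {ρ : R →+* ZMod 2}

theorem odd_integer (h : RamifiedConj σ ρ) {a : R} (ha : a ∈ (Int.castRingHom R).range)
    (ha' : ρ a = 1) : a = 1 ∨ a = 5 ∨ a = -1 ∨ a = -5 := by
  obtain ⟨k, rfl⟩ := ha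
  have h8 := h.eight
  have hodd : (k : ZMod 2) = 1 := by simpa using ha'
  have h2 : k % 2 = 1 := by
    rw [← Int.cast_one, ZMod.intCast_eq_intCast_iff] at hodd
    exact hodd
  have hk : k = 8 * (k / 8) + k % 8 := by omega
  have hk' : ((k : ℤ) : R) = ((k % 8 : ℤ) : R) := by
    conv_lhs => rw [hk]
    push_cast
    rw [h8]; ring
  have : k % 8 = 1 ∨ k % 8 = 5 ∨ k % 8 = 7 ∨ k % 8 = 3 := by omega
  rw [eq_intCast, hk']
  rcases this with h | h | h | h <;> rw [h] <;> push_cast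
  · simp
  · simp
  · right; right; left; linear_combination h8
  · right; right; right; linear_combination h8

theorem sq_odd_integer (h : RamifiedConj σ ρ) {a : R} (ha : a ∈ (Int.castRingHom R).range)
    (ha' : ρ a = 1) : a * a = 1 := by
  rcases h.odd_integer ha ha' with rfl | rfl | rfl | rfl
  · ring
  · linear_combination 3 * h.eight
  · ring
  · linear_combination 3 * h.eight

theorem conj_integer {a : R} (ha : a ∈ (Int.castRingHom R).range) : σ a = a := by
  obtain ⟨k, rfl⟩ := ha
  simp

theorem isUnit_iff (h : RamifiedConj σ ρ) {r : R} : IsUnit r ↔ ρ r = 1 := by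
  constructor
  · intro hr
    have := (hr.map ρ).ne_zero
    generalize ρ r = z at *
    revert z; decide
  · intro hr
    rcases h.norm_odd r hr with h1 | h5
    · exact IsUnit.of_mul_eq_one _ h1
    · exact IsUnit.of_mul_eq_one (σ r * 5) (by linear_combination 5 * h5 + 3 * h.eight)

theorem represents_scalar (h : RamifiedConj σ ρ) {a : R} (ha : a ∈ (Int.castRingHom R).range)
    (ha' : ρ a = 1) : ∃ ε : R, (ε = 1 ∨ ε = -1) ∧
      IsRepresentedBy σ (a • (1 : Matrix Unit Unit R)) (ε • (1 : Matrix Unit Unit R)) := by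
  obtain ⟨u, hu⟩ := h.exists_norm_five
  rcases h.odd_integer ha ha' with rfl | rfl | rfl | rfl
  · exact ⟨1, .inl rfl, .refl _⟩
  · exact ⟨1, .inl rfl, .scalar_of_norm (u := u) (by simp [hu])⟩
  · exact ⟨-1, .inr rfl, .refl _⟩
  · exact ⟨-1, .inr rfl, .scalar_of_norm (u := u) (by simp [hu])⟩

/-- A product of two signs can be moved into the first diagonal entry. -/
theorem represents_pair (h : RamifiedConj σ ρ) {α β : R} (hα : α = 1 ∨ α = -1)
    (hβ : β = 1 ∨ β = -1) :
    IsRepresentedBy σ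
      (fromBlocks (α • (1 : Matrix Unit Unit R)) 0 0 (β • (1 : Matrix Unit Unit R)))
      (fromBlocks ((α * β) • (1 : Matrix Unit Unit R)) 0 0 (1 : Matrix Unit Unit R)) := by
  rcases hβ with rfl | rfl
  · simpa using IsRepresentedBy.refl _
  rcases hα with rfl | rfl
  · refine ⟨fromBlocks 0 1 1 0, ?_⟩
    simp [fromBlocks_map, fromBlocks_transpose, fromBlocks_multiply]
  · obtain ⟨x, y, hxy⟩ := h.exists_norm_add
    refine ⟨fromBlocks (x • 1) (y • 1) ((-σ y) • 1) (σ x • 1), ?_⟩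
    ext (i | i) (j | j) <;>
      simp [fromBlocks_map, fromBlocks_transpose, fromBlocks_multiply, h.conj_conj] <;>
      first | linear_combination hxy | ring

theorem exists_split (h : RamifiedConj σ ρ) {m : ℕ} {H : Matrix (Fin (m + 1)) (Fin (m + 1)) R}
    (hH : IsUnitHermitian σ ρ H) :
    ∃ a ∈ (Int.castRingHom R).range, ρ a = 1 ∧ ∃ D : Matrix (Fin m) (Fin m) R,
      IsUnitHermitian σ ρ D ∧
        IsRepresentedBy σ H (fromBlocks (a • (1 : Matrix Unit Unit R)) 0 0 D) := by
  have e : Unit ⊕ Fin m ≃ Fin (m + 1) := Fintype.equivOfCardEq (by simp [add_comm])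
  set a := H (e (.inl ())) (e (.inl ()))
  have ha := hH.diag (e (.inl ()))
  have ha' : ρ a = 1 := by simp [a, hH.residue]
  set b : Matrix Unit (Fin m) R := Matrix.of fun _ j => H (e (.inl ())) (e (.inr j))
  set D : Matrix (Fin m) (Fin m) R := Matrix.of fun i j => H (e (.inr i)) (e (.inr j))
  have hb : ∀ j, ρ (b () j) = 0 := fun j => by simp [b, hH.residue]
  have hsplit : H.submatrix e e =
      fromBlocks (a • (1 : Matrix Unit Unit R)) b (b.map σ)ᵀ D := by
    ext (i | i) (j | j) <;> simp [a, b, D, hH.conj]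
  refine ⟨a, ha, ha', D - a • ((b.map σ)ᵀ * b), ⟨fun i => ?_, fun i j => ?_, fun i j => ?_⟩, ?_⟩
  · refine sub_mem (hH.diag _) ?_
    simp only [Matrix.smul_apply, Matrix.mul_apply, Finset.univ_unique, Finset.sum_singleton,
      smul_eq_mul]
    refine mul_mem ha ?_
    simpa [mul_comm] using h.norm_mem (b () i)
  · have hD : σ (D i j) = D j i := hH.conj _ _
    have haσ : σ a = a := conj_integer ha
    simp [Matrix.mul_apply, hD, h.conj_conj, haσ, mul_comm]
  · have hD : ρ (D i j) = (1 : Matrix (Fin m) (Fin m) (ZMod 2)) i j := by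
      simp [D, hH.residue, Matrix.one_apply]
    simp [Matrix.mul_apply, hD, h.residue_conj, hb]
  · refine (IsRepresentedBy.submatrix_right H e).trans ?_
    rw [hsplit]
    exact .schur (h.sq_odd_integer ha ha') (conj_integer ha) _
      (by ext; simp [h.conj_conj]) _

/-- Classification: a unit hermitian form of positive rank is `diag(±1, 1, …, 1)`. -/
theorem exists_normal_form (h : RamifiedConj σ ρ) (m : ℕ)
    {H : Matrix (Fin (m + 1)) (Fin (m + 1)) R} (hH : IsUnitHermitian σ ρ H) :
    ∃ ε : R, (ε = 1 ∨ ε = -1) ∧ IsRepresentedBy σ H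
      (fromBlocks (ε • (1 : Matrix Unit Unit R)) 0 0 (1 : Matrix (Fin m) (Fin m) R)) := by
  induction m with
  | zero =>
    obtain ⟨a, ha, ha', D, -, hD⟩ := h.exists_split hH
    obtain ⟨ε, hε, hr⟩ := h.represents_scalar ha ha'
    refine ⟨ε, hε, hD.trans (.fromBlocks hr ?_)⟩
    rw [Subsingleton.elim D 1]
    exact .refl _
  | succ m ih =>
    obtain ⟨a, ha, ha', D, hD, hHD⟩ := h.exists_split hH
    obtain ⟨α, hα, hr⟩ := h.represents_scalar ha ha'
    obtain ⟨β, hβ, hDβ⟩ := ih hD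
    refine ⟨α * β, ?_, (hHD.trans (hr.fromBlocks hDβ)).trans ?_⟩
    · rcases hα with rfl | rfl <;> rcases hβ with rfl | rfl <;> simp
    have key := (h.represents_pair hα hβ).fromBlocks
      (IsRepresentedBy.refl (σ := σ) (1 : Matrix (Fin m) (Fin m) R))
    have e : Fin (m + 1) ≃ Unit ⊕ Fin m := Fintype.equivOfCardEq (by simp [add_comm])
    have h₁ := (IsRepresentedBy.submatrix_left (σ := σ) (fromBlocks
      (fromBlocks (α • (1 : Matrix Unit Unit R)) 0 0 (β • (1 : Matrix Unit Unit R))) 0 0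
      (1 : Matrix (Fin m) (Fin m) R)) (Equiv.sumAssoc Unit Unit (Fin m)).symm)
    have h₂ := (IsRepresentedBy.submatrix_right (σ := σ) (fromBlocks
      (fromBlocks ((α * β) • (1 : Matrix Unit Unit R)) 0 0 (1 : Matrix Unit Unit R)) 0 0
      (1 : Matrix (Fin m) (Fin m) R))
      (((Equiv.refl Unit).sumCongr e).trans (Equiv.sumAssoc Unit Unit (Fin m)).symm))
    have := (h₁.trans key).trans h₂
    convert this using 1
    · ext (i | i | i) (j | j | j) <;> simp [Matrix.one_apply]
    · ext (i | i) (j | j)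
      · simp
      · simp
        rcases e j with k | k <;> simp
      · simp
        rcases e i with k | k <;> simp
      · have : (1 : Matrix (Fin (m + 1)) (Fin (m + 1)) R) i j =
            (1 : Matrix (Unit ⊕ Fin m) (Unit ⊕ Fin m) R) (e i) (e j) := by
          simp [Matrix.one_apply]
        rw [← fromBlocks_one] at this
        simp [this]
        rcases e i with k | k <;> rcases e j with l | l <;> simp [Matrix.one_apply]

end RamifiedConj

theorem Nat.card_eq_mul_of_card_fiber {α β : Type*} [Finite α] [Finite β] (f : α → β) (k : ℕ)
    (h : ∀ b, Nat.card {a // f a = b} = k) : Nat.card α = Nat.card β * k := by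
  have := Fintype.ofFinite β
  rw [← Nat.card_congr (Equiv.sigmaFiberEquiv f), Nat.card_sigma]
  simp [h]

namespace IsUnitHermitian

variable {R : Type*} [CommRing R] {σ : R →+* R} {ρ : R →+* ZMod 2}

theorem submatrix {ι κ : Type*} [DecidableEq ι] [DecidableEq κ] {H : Matrix ι ι R}
    (hH : IsUnitHermitian σ ρ H) {f : κ → ι} (hf : f.Injective) :
    IsUnitHermitian σ ρ (H.submatrix f f) where
  diag _ := hH.diag _
  conj _ _ := hH.conj _ _
  residue i j := by simp [hH.residue, Matrix.one_apply, hf.eq_iff]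

theorem map_residue {ι : Type*} [DecidableEq ι] {H : Matrix ι ι R}
    (hH : IsUnitHermitian σ ρ H) : H.map ρ = 1 := by
  ext i j
  simp [hH.residue]

theorem residue_det {ι : Type*} [DecidableEq ι] [Fintype ι] {H : Matrix ι ι R}
    (hH : IsUnitHermitian σ ρ H) : ρ H.det = 1 := by
  rw [RingHom.map_det, RingHom.mapMatrix_apply, hH.map_residue, det_one]

theorem add_single {ι : Type*} [DecidableEq ι] {H : Matrix ι ι R}
    (hH : IsUnitHermitian σ ρ H) (i₀ : ι) (k : ℤ) :
    IsUnitHermitian σ ρ (H + Matrix.single i₀ i₀ ((2 * k : ℤ) : R)) where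
  diag i := by
    refine add_mem (hH.diag i) ?_
    rw [Matrix.single_apply]
    split_ifs
    · exact ⟨_, rfl⟩
    · exact zero_mem _
  conj i j := by
    simp only [Matrix.add_apply, map_add, hH.conj, Matrix.single_apply, apply_ite σ, map_intCast,
      map_zero, and_comm]
  residue i j := by
    have h2 : ρ 2 = 0 := by rw [map_ofNat]; rfl
    simp [hH.residue, Matrix.single_apply, apply_ite ρ, h2]

theorem congr {ι : Type*} [DecidableEq ι] [Fintype ι] (h : RamifiedConj σ ρ) {J : Matrix ι ι R}
    {δ : ι → R} (hJ : IsUnitHermitian σ ρ J) (hδ : J = diagonal δ) {A : Matrix ι ι R}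
    (hA : A.map ρ * (A.map ρ)ᵀ = 1) : IsUnitHermitian σ ρ (A * J * (A.map σ)ᵀ) where
  diag i := by
    have hδ' : ∀ i, δ i ∈ (Int.castRingHom R).range := fun i => by simpa [hδ] using hJ.diag i
    rw [hδ, Matrix.mul_apply]
    refine sum_mem fun j _ => ?_
    simp only [mul_diagonal, transpose_apply, map_apply]
    rw [mul_right_comm]
    exact mul_mem (h.norm_mem _) (hδ' j)
  conj i j := by
    have hJσ : (J.map σ)ᵀ = J := by ext i j; simp [hJ.conj]
    have : ((A * J * (A.map σ)ᵀ).map σ)ᵀ = A * J * (A.map σ)ᵀ := by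
      have hAσ : (A.map σ).map σ = A := by ext; simp [h.conj_conj]
      rw [Matrix.map_mul, Matrix.map_mul, transpose_mul, transpose_mul, hJσ, transpose_map,
        transpose_transpose, hAσ, Matrix.mul_assoc]
    exact congrFun (congrFun this j) i
  residue i j := by
    have hAσ : (A.map σ).map ρ = A.map ρ := by ext; simp [h.residue_conj]
    have : (A * J * (A.map σ)ᵀ).map ρ = 1 := by
      rw [Matrix.map_mul, Matrix.map_mul, hJ.map_residue, transpose_map, hAσ, mul_one, hA]
    exact congrFun (congrFun this i) j

end IsUnitHermitian

theorem det_mul_mul_conj {R ι : Type*} [CommRing R] [Fintype ι] [DecidableEq ι] {σ : R →+* R}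
    (A K : Matrix ι ι R) :
    (A * K * (A.map σ)ᵀ).det = A.det * σ A.det * K.det := by
  rw [det_mul, det_mul, det_transpose, RingHom.map_det, RingHom.mapMatrix_apply]
  ring

namespace RamifiedConj

variable {R : Type*} [CommRing R] {σ : R →+* R} {ρ : R →+* ZMod 2}

theorem two_mul_odd (h : RamifiedConj σ ρ) {a : R} (ha : a = 1 ∨ a = 5 ∨ a = -1 ∨ a = -5) :
    2 * a = 2 ∨ 2 * a = -2 := by
  rcases ha with rfl | rfl | rfl | rfl
  · left; ring
  · left; linear_combination h.eight
  · right; ring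
  · right; linear_combination - h.eight

theorem four_mul_odd (h : RamifiedConj σ ρ) {a : R} (ha : a = 1 ∨ a = 5 ∨ a = -1 ∨ a = -5) :
    4 * a = 4 := by
  rcases ha with rfl | rfl | rfl | rfl
  · ring
  · linear_combination 2 * h.eight
  · linear_combination - h.eight
  · linear_combination -3 * h.eight

theorem two_ne_neg_two (h : RamifiedConj σ ρ) : (2 : R) ≠ -2 := fun h2 =>
  h.four_ne (by linear_combination h2)

theorem residue_of_norm {a b c : R} (h : RamifiedConj σ ρ) (ha : a = b * σ b * c)
    (hρ : ρ a = 1) : ρ b = 1 := by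
  rw [ha, map_mul, map_mul, h.residue_conj] at hρ
  generalize ρ b = x at *
  generalize ρ c = y at *
  revert x y; decide

theorem two_mul_norm (h : RamifiedConj σ ρ) {b : R} (hb : ρ b = 1) : 2 * (b * σ b) = 2 := by
  rcases h.norm_odd b hb with h1 | h1 <;> rw [h1]
  · ring
  · linear_combination h.eight

theorem exists_square_normal_form (h : RamifiedConj σ ρ) (m : ℕ) :
    ∃ K : R → Matrix (Fin (m + 1)) (Fin (m + 1)) R, (∀ ε, (K ε).det = ε) ∧
      ∀ H : Matrix (Fin (m + 1)) (Fin (m + 1)) R, IsUnitHermitian σ ρ H →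
        ∃ ε : R, (ε = 1 ∨ ε = -1) ∧ IsRepresentedBy σ H (K ε) := by
  have e : Fin (m + 1) ≃ Unit ⊕ Fin m := Fintype.equivOfCardEq (by simp [add_comm])
  refine ⟨fun ε => (fromBlocks (ε • (1 : Matrix Unit Unit R)) 0 0 1).submatrix e e,
    fun ε => ?_, fun H hH => ?_⟩
  · simp [det_submatrix_equiv_self]
  · obtain ⟨ε, hε, hK⟩ := h.exists_normal_form m hH
    exact ⟨ε, hε, hK.trans (.submatrix_right _ e)⟩

theorem det_odd (h : RamifiedConj σ ρ) {m : ℕ} {H : Matrix (Fin m) (Fin m) R}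
    (hH : IsUnitHermitian σ ρ H) : H.det = 1 ∨ H.det = 5 ∨ H.det = -1 ∨ H.det = -5 := by
  cases m with
  | zero => simp
  | succ m =>
    obtain ⟨K, hK, hr⟩ := h.exists_square_normal_form m
    obtain ⟨ε, hε, A, hA⟩ := hr H hH
    have hdet : H.det = A.det * σ A.det * ε := by rw [← hA, det_mul_mul_conj, hK]
    have := h.norm_odd _ (h.residue_of_norm hdet hH.residue_det)
    rw [hdet]
    rcases this with h1 | h1 <;> rw [h1] <;> rcases hε with rfl | rfl <;> simp

/-- Two unit hermitian forms with the same discriminant modulo norms are isometric. -/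
theorem represented_of_det (h : RamifiedConj σ ρ) {m : ℕ}
    {H J : Matrix (Fin (m + 1)) (Fin (m + 1)) R} (hH : IsUnitHermitian σ ρ H)
    (hJ : IsUnitHermitian σ ρ J) (hd : 2 * H.det = 2 * J.det) : IsRepresentedBy σ H J := by
  obtain ⟨K, hK, hr⟩ := h.exists_square_normal_form m
  obtain ⟨ε, hε, hHK⟩ := hr H hH
  obtain ⟨ε', hε', B, hB⟩ := hr J hJ
  have hdB : J.det = B.det * σ B.det * ε' := by rw [← hB, det_mul_mul_conj, hK]
  have hBu := h.residue_of_norm hdB hJ.residue_det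
  have hee : ε = ε' := by
    obtain ⟨A, hA⟩ := hHK
    have hdA : H.det = A.det * σ A.det * ε := by rw [← hA, det_mul_mul_conj, hK]
    have hA2 := h.two_mul_norm (h.residue_of_norm hdA hH.residue_det)
    have hB2 := h.two_mul_norm hBu
    have key : 2 * ε = 2 * ε' := by
      linear_combination hd - 2 * hdA + 2 * hdB - hA2 * ε + hB2 * ε'
    have hne := h.two_ne_neg_two
    rcases hε with rfl | rfl <;> rcases hε' with rfl | rfl
    · rfl
    · exact absurd (by linear_combination key) hne
    · exact absurd (by linear_combination -key) hne
    · rfl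
  subst hee
  refine hHK.trans ⟨B⁻¹, ?_⟩
  have hinv : B⁻¹ * B = 1 := nonsing_inv_mul _ (h.isUnit_iff.2 hBu)
  rw [← hB, show B⁻¹ * (B * K ε * (B.map σ)ᵀ) * (B⁻¹.map σ)ᵀ
    = (B⁻¹ * B) * K ε * ((B⁻¹ * B).map σ)ᵀ by
      simp only [Matrix.map_mul, transpose_mul, Matrix.mul_assoc], hinv]
  simp [Matrix.map_one]

theorem det_add_single {m : ℕ} (H : Matrix (Fin (m + 1)) (Fin (m + 1)) R) (c : R) :
    (H + Matrix.single 0 0 c).det = H.det + c * (H.submatrix Fin.succ Fin.succ).det := by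
  have hsub : ∀ f : Fin m → Fin (m + 1), (H + Matrix.single 0 0 c).submatrix Fin.succ f =
      H.submatrix Fin.succ f := fun f => by
    ext i j; simp [(Fin.succ_ne_zero i).symm]
  rw [det_succ_row_zero, det_succ_row_zero]
  simp only [hsub, Fin.sum_univ_succ]
  simp [(Fin.succ_ne_zero _).symm]
  ring

theorem two_mul_det_add_single (h : RamifiedConj σ ρ) {m : ℕ}
    {H : Matrix (Fin (m + 1)) (Fin (m + 1)) R} (hH : IsUnitHermitian σ ρ H) :
    2 * (H + Matrix.single 0 0 2).det = 2 * H.det + 4 := by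
  rw [det_add_single]
  linear_combination h.four_mul_odd (h.det_odd (hH.submatrix (Fin.succ_injective m)))

theorem card_isUnitHermitian_eq_two_mul [Finite R] (h : RamifiedConj σ ρ) {m : ℕ}
    {J : Matrix (Fin (m + 1)) (Fin (m + 1)) R} (hJ : IsUnitHermitian σ ρ J) :
    Nat.card {H : Matrix (Fin (m + 1)) (Fin (m + 1)) R // IsUnitHermitian σ ρ H} =
      2 * Nat.card {H : Matrix (Fin (m + 1)) (Fin (m + 1)) R //
        IsUnitHermitian σ ρ H ∧ 2 * H.det = 2 * J.det} := by
  classical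
  rw [Nat.card_eq_mul_of_card_fiber (β := Bool) (fun H => decide (2 * H.1.det = 2 * J.det)) _
    fun b => ?_, Nat.card_eq_fintype_card, Fintype.card_bool]
  have e : {H : Matrix (Fin (m + 1)) (Fin (m + 1)) R //
        IsUnitHermitian σ ρ H ∧ ¬ 2 * H.det = 2 * J.det} ≃
      {H : Matrix (Fin (m + 1)) (Fin (m + 1)) R //
        IsUnitHermitian σ ρ H ∧ 2 * H.det = 2 * J.det} := by
    refine (Equiv.addRight (Matrix.single 0 0 2)).subtypeEquiv fun H => ?_
    have hiff : IsUnitHermitian σ ρ (H + Matrix.single 0 0 2) ↔ IsUnitHermitian σ ρ H := by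
      refine ⟨fun hH => ?_, fun hH => ?_⟩
      · simpa [← Matrix.single_neg, add_assoc] using hH.add_single 0 (-1)
      · simpa using hH.add_single 0 1
    rw [Equiv.coe_addRight, hiff]
    refine and_congr_right fun hH => ?_
    rw [h.two_mul_det_add_single hH]
    have hne := h.two_ne_neg_two
    rcases h.two_mul_odd (h.det_odd hH) with h1 | h1 <;>
      rcases h.two_mul_odd (h.det_odd hJ) with h2 | h2 <;> rw [h1, h2]
    · simp [h.four_ne]
    · simp only [hne, not_false_eq_true, true_iff]
      linear_combination h.eight
    · simp only [hne.symm, not_false_eq_true, true_iff]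
      ring
    · simp [h.four_ne]
  cases b with
  | true =>
    simp only [decide_eq_true_eq]
    exact Nat.card_congr (Equiv.subtypeSubtypeEquivSubtypeInter _
      (fun H : Matrix (Fin (m + 1)) (Fin (m + 1)) R => 2 * H.det = 2 * J.det))
  | false =>
    simp only [decide_eq_false_iff_not]
    exact Nat.card_congr ((Equiv.subtypeSubtypeEquivSubtypeInter _
      (fun H : Matrix (Fin (m + 1)) (Fin (m + 1)) R => ¬ 2 * H.det = 2 * J.det)).trans e)

/-- Orbit-stabilizer for the action of the matrices that are orthogonal over the residue field. -/
theorem card_residually_orthogonal [Finite R] (h : RamifiedConj σ ρ) {m : ℕ}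
    {J : Matrix (Fin (m + 1)) (Fin (m + 1)) R} (hJ : IsUnitHermitian σ ρ J)
    {δ : Fin (m + 1) → R} (hδ : J = diagonal δ) :
    Nat.card {A : Matrix (Fin (m + 1)) (Fin (m + 1)) R // A.map ρ * (A.map ρ)ᵀ = 1} =
      Nat.card {H : Matrix (Fin (m + 1)) (Fin (m + 1)) R //
          IsUnitHermitian σ ρ H ∧ 2 * H.det = 2 * J.det} *
        Nat.card {A : Matrix (Fin (m + 1)) (Fin (m + 1)) R // A * J * (A.map σ)ᵀ = J} := by
  have orth : ∀ {A H : Matrix (Fin (m + 1)) (Fin (m + 1)) R}, IsUnitHermitian σ ρ H →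
      A * J * (A.map σ)ᵀ = H → A.map ρ * (A.map ρ)ᵀ = 1 := fun {A H} hH hA => by
    have hAσ : (A.map σ).map ρ = A.map ρ := by ext; simp [h.residue_conj]
    rw [← hH.map_residue, ← hA, Matrix.map_mul, Matrix.map_mul, hJ.map_residue, transpose_map, hAσ,
      mul_one]
  have detu : ∀ {A : Matrix (Fin (m + 1)) (Fin (m + 1)) R}, A.map ρ * (A.map ρ)ᵀ = 1 →
      ρ A.det = 1 := fun {A} hA => by
    have := congrArg det hA
    rw [det_mul, det_transpose, det_one, ← RingHom.mapMatrix_apply, ← RingHom.map_det] at this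
    generalize ρ A.det = x at *
    revert x; decide
  let f : {A : Matrix (Fin (m + 1)) (Fin (m + 1)) R // A.map ρ * (A.map ρ)ᵀ = 1} →
      {H : Matrix (Fin (m + 1)) (Fin (m + 1)) R //
        IsUnitHermitian σ ρ H ∧ 2 * H.det = 2 * J.det} := fun A =>
    ⟨A.1 * J * (A.1.map σ)ᵀ, hJ.congr h hδ A.2, by
      rw [det_mul_mul_conj]
      linear_combination J.det * h.two_mul_norm (detu A.2)⟩
  refine Nat.card_eq_mul_of_card_fiber f _ fun ⟨H, hH, hd⟩ => ?_
  obtain ⟨A₀, hA₀⟩ := h.represented_of_det hH hJ hd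
  have hu : IsUnit A₀.det := h.isUnit_iff.2 (detu (orth hH hA₀))
  have hinv : A₀⁻¹ * A₀ = 1 := nonsing_inv_mul _ hu
  have hinv' : A₀ * A₀⁻¹ = 1 := mul_nonsing_inv _ hu
  have act : ∀ C A : Matrix (Fin (m + 1)) (Fin (m + 1)) R,
      (C * A) * J * ((C * A).map σ)ᵀ = C * (A * J * (A.map σ)ᵀ) * (C.map σ)ᵀ := fun C A => by
    simp only [Matrix.map_mul, transpose_mul, Matrix.mul_assoc]
  have hJ' : A₀⁻¹ * H * (A₀⁻¹.map σ)ᵀ = J := by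
    rw [← hA₀, ← act, hinv]
    simp [Matrix.map_one]
  refine Nat.card_congr
    { toFun := fun A => ⟨A₀⁻¹ * A.1.1, ?_⟩
      invFun := fun B => ⟨⟨A₀ * B.1, ?_⟩, ?_⟩
      left_inv := fun A => ?_
      right_inv := fun B => ?_ }
  · have hA : A.1.1 * J * (A.1.1.map σ)ᵀ = H := congrArg Subtype.val A.2
    rw [act, hA, hJ']
  · exact orth hH (by rw [act, B.2, hA₀])
  · exact Subtype.ext (by simp only [f]; rw [act, B.2, hA₀])
  · ext1; ext1; simp [← Matrix.mul_assoc, hinv']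
  · ext1; simp [← Matrix.mul_assoc, hinv]

/-- The determinant of a unitary matrix is any of the sixteen elements of norm one. -/
theorem card_unitary_eq [Finite R] (h : RamifiedConj σ ρ) {m : ℕ} (δ : Fin (m + 1) → R)
    (hδ : IsUnit (diagonal δ).det) :
    Nat.card {A : Matrix (Fin (m + 1)) (Fin (m + 1)) R //
        A * diagonal δ * (A.map σ)ᵀ = diagonal δ} =
      16 * Nat.card {A : Matrix (Fin (m + 1)) (Fin (m + 1)) R //
        A * diagonal δ * (A.map σ)ᵀ = diagonal δ ∧ A.det = 1} := by
  rw [← h.card_norm_one, ← Nat.card_prod]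
  let D : R → Matrix (Fin (m + 1)) (Fin (m + 1)) R := fun u => diagonal (Fin.cons u 1)
  have hD : ∀ u, (D u).det = u := fun u => by simp [D, Fin.prod_univ_succ]
  have hD1 : D 1 = 1 := by
    ext i j; simp only [D, diagonal_apply, Matrix.one_apply]
    refine Fin.cases ?_ (fun i => ?_) i <;> simp
  have hDm : ∀ u v, D u * D v = D (u * v) := fun u v => by
    simp only [D, diagonal_mul_diagonal]
    congr 1; ext i; refine Fin.cases ?_ (fun i => ?_) i <;> simp
  have hDσ : ∀ u, (D u).map σ = D (σ u) := fun u => by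
    simp only [D]
    rw [diagonal_map (map_zero σ)]
    congr 1; ext i; refine Fin.cases ?_ (fun i => ?_) i <;> simp
  have hDT : ∀ u, (D u)ᵀ = D u := fun u => by simp [D]
  have hDδ : ∀ u, D u * diagonal δ = diagonal δ * D u := fun u => by
    simp [D, diagonal_mul_diagonal, mul_comm]
  have act : ∀ u, u * σ u = 1 → ∀ A : Matrix (Fin (m + 1)) (Fin (m + 1)) R,
      A * diagonal δ * (A.map σ)ᵀ = diagonal δ →
      (D u * A) * diagonal δ * ((D u * A).map σ)ᵀ = diagonal δ := fun u hu A hA => by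
    rw [Matrix.map_mul, transpose_mul, hDσ, hDT,
      show D u * A * diagonal δ * ((A.map σ)ᵀ * D (σ u)) =
        D u * (A * diagonal δ * (A.map σ)ᵀ) * D (σ u) by simp only [Matrix.mul_assoc], hA, hDδ,
      Matrix.mul_assoc, hDm, hu, hD1, mul_one]
  have norm_det : ∀ A : Matrix (Fin (m + 1)) (Fin (m + 1)) R,
      A * diagonal δ * (A.map σ)ᵀ = diagonal δ → A.det * σ A.det = 1 := fun A hA => by
    have := congrArg det hA
    rw [det_mul_mul_conj] at this
    exact hδ.mul_right_cancel (by rw [this, one_mul])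
  refine Nat.card_congr
    { toFun := fun A => (⟨A.1.det, norm_det _ A.2⟩, ⟨D (σ A.1.det) * A.1, act _ ?_ _ A.2, ?_⟩)
      invFun := fun p => ⟨D p.1.1 * p.2.1, act _ p.1.2 _ p.2.2.1⟩
      left_inv := fun A => ?_
      right_inv := fun p => ?_ }
  · rw [h.conj_conj, mul_comm, norm_det _ A.2]
  · rw [det_mul, hD, mul_comm, norm_det _ A.2]
  · ext1; simp [← Matrix.mul_assoc, hDm, norm_det _ A.2, hD1]
  · obtain ⟨⟨u, hu⟩, ⟨A, hA, hdet⟩⟩ := p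
    simp [hD, hdet, ← Matrix.mul_assoc, hDm, mul_comm (σ u), hu, hD1]

theorem card_lift_orthogonal [Finite R] (h : RamifiedConj σ ρ) (m : ℕ) :
    Nat.card {A : Matrix (Fin m) (Fin m) R // A.map ρ * (A.map ρ)ᵀ = 1} =
      Nat.card {B : Matrix (Fin m) (Fin m) (ZMod 2) // B * Bᵀ = 1} * 32 ^ (m ^ 2) := by
  let f : {A : Matrix (Fin m) (Fin m) R // A.map ρ * (A.map ρ)ᵀ = 1} →
    {B : Matrix (Fin m) (Fin m) (ZMod 2) // B * Bᵀ = 1} := fun A => ⟨A.1.map ρ, A.2⟩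
  refine Nat.card_eq_mul_of_card_fiber f _ fun ⟨B, hB⟩ => ?_
  rw [Nat.card_congr (β := ∀ i j, {r // ρ r = B i j})
    { toFun := fun A i j => ⟨A.1.1 i j, congrFun (congrFun (congrArg Subtype.val A.2) i) j⟩
      invFun := fun g =>
        have hg : (Matrix.of fun i j => (g i j).1).map ρ = B := by
          ext i j; exact (g i j).2
        ⟨⟨Matrix.of fun i j => (g i j).1, by rw [hg, hB]⟩, Subtype.ext hg⟩
      left_inv := fun A => rfl
      right_inv := fun g => rfl }]
  simp [Nat.card_pi, h.card_fiber, ← pow_mul, sq]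

theorem card_odd_integer (h : RamifiedConj σ ρ) :
    Nat.card {a : R // a ∈ (Int.castRingHom R).range ∧ ρ a = 1} = 4 := by
  classical
  have h8 := h.eight
  have h4 := h.four_ne
  have hρ5 : ρ 5 = 1 := by rw [map_ofNat]; rfl
  have hρn : (-1 : ZMod 2) = 1 := rfl
  have hset : {a : R | a ∈ (Int.castRingHom R).range ∧ ρ a = 1} =
      (({1, 5, -1, -5} : Finset R) : Set R) := by
    ext a
    simp only [Set.mem_ofPred_eq, Finset.coe_insert, Finset.coe_singleton, Set.mem_insert_iff,
      Set.mem_singleton_iff]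
    refine ⟨fun ha => h.odd_integer ha.1 ha.2, ?_⟩
    rintro (rfl | rfl | rfl | rfl)
    · exact ⟨one_mem _, map_one ρ⟩
    · exact ⟨⟨5, by simp⟩, hρ5⟩
    · exact ⟨⟨-1, by simp⟩, by simp [hρn]⟩
    · exact ⟨⟨-5, by simp⟩, by simp [hρ5, hρn]⟩
  have hc : Nat.card {a : R | a ∈ (Int.castRingHom R).range ∧ ρ a = 1} = 4 := by
    rw [hset, Nat.card_coe_set_eq, Set.ncard_coe_finset]
    have n1 : (1 : R) ≠ 5 := fun e => h4 (by linear_combination -e)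
    have n2 : (1 : R) ≠ -1 := fun e => h4 (by linear_combination 2 * e)
    have n3 : (1 : R) ≠ -5 := fun e => h4 (by linear_combination -2 * e + 2 * h8)
    have n4 : (5 : R) ≠ -1 := fun e => h4 (by linear_combination 2 * e - h8)
    have n5 : (5 : R) ≠ -5 := fun e => h4 (by linear_combination 2 * e - 2 * h8)
    have n6 : (-1 : R) ≠ -5 := fun e => h4 (by linear_combination e)
    rw [Finset.card_insert_of_notMem (by simp [n1, n2, n3]),
      Finset.card_insert_of_notMem (by simp [n4, n5]),
      Finset.card_insert_of_notMem (by simpa using n6), Finset.card_singleton]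
  exact hc

theorem card_isUnitHermitian_zero :
    Nat.card {H : Matrix (Fin 0) (Fin 0) R // IsUnitHermitian σ ρ H} = 1 := by
  rw [Nat.card_eq_one_iff_unique]
  exact ⟨inferInstance, ⟨⟨1, ⟨fun i => i.elim0, fun i => i.elim0, fun i => i.elim0⟩⟩⟩⟩

/-- The matrix with first row `(a, b)`, conjugate first column, and lower right block `D`. -/
def borderedMatrix (σ : R →+* R) {m : ℕ} (a : R) (b : Fin m → R) (D : Matrix (Fin m) (Fin m) R) :
    Matrix (Fin (m + 1)) (Fin (m + 1)) R :=
  Matrix.of (Fin.cons (Fin.cons a b) fun i => Fin.cons (σ (b i)) (D i))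

theorem card_isUnitHermitian_succ (h : RamifiedConj σ ρ) (m : ℕ) :
    Nat.card {H : Matrix (Fin (m + 1)) (Fin (m + 1)) R // IsUnitHermitian σ ρ H} =
      4 * 32 ^ m * Nat.card {H : Matrix (Fin m) (Fin m) R // IsUnitHermitian σ ρ H} := by
  have key : ∀ (a : R) (b : Fin m → R) (D : Matrix (Fin m) (Fin m) R),
      (a ∈ (Int.castRingHom R).range ∧ ρ a = 1) → (∀ i, ρ (b i) = 0) → IsUnitHermitian σ ρ D →
      IsUnitHermitian σ ρ (borderedMatrix σ a b D) := fun a b D ha hb hD => by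
    refine ⟨Fin.cases ?_ fun i => ?_, Fin.cases (Fin.cases ?_ fun j => ?_) fun i =>
      Fin.cases ?_ fun j => ?_, Fin.cases (Fin.cases ?_ fun j => ?_) fun i =>
      Fin.cases ?_ fun j => ?_⟩
    · simpa [borderedMatrix] using ha.1
    · simpa [borderedMatrix] using hD.diag i
    · simpa [borderedMatrix] using conj_integer ha.1
    · simp [borderedMatrix]
    · simp [borderedMatrix, h.conj_conj]
    · simpa [borderedMatrix] using hD.conj i j
    · simpa [borderedMatrix] using ha.2
    · simpa [borderedMatrix, (Fin.succ_ne_zero j).symm] using hb j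
    · simpa [borderedMatrix, h.residue_conj] using hb i
    · simpa [borderedMatrix, Matrix.one_apply] using hD.residue i j
  rw [Nat.card_congr (β := {a : R // a ∈ (Int.castRingHom R).range ∧ ρ a = 1} ×
      (Fin m → {b : R // ρ b = 0}) × {H : Matrix (Fin m) (Fin m) R // IsUnitHermitian σ ρ H})
    { toFun := fun H => (⟨H.1 0 0, H.2.diag 0, by simp [H.2.residue]⟩,
        fun j => ⟨H.1 0 j.succ, by simp [H.2.residue, (Fin.succ_ne_zero j).symm]⟩,
        ⟨H.1.submatrix Fin.succ Fin.succ, H.2.submatrix (Fin.succ_injective m)⟩)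
      invFun := fun p => ⟨borderedMatrix σ p.1.1 (fun j => (p.2.1 j).1) p.2.2.1,
        key _ _ _ p.1.2 (fun j => (p.2.1 j).2) p.2.2.2⟩
      left_inv := fun H => ?_
      right_inv := fun p => ?_ }]
  · rw [Nat.card_prod, Nat.card_prod, h.card_odd_integer, Nat.card_fun, h.card_fiber, Nat.card_fin,
      mul_assoc]
  · ext i j
    refine Fin.cases (Fin.cases ?_ (fun j => ?_) j) (fun i => Fin.cases ?_ (fun j => ?_) j) i <;>
      simp [borderedMatrix, H.2.conj]
  · obtain ⟨⟨a, ha⟩, b, ⟨D, hD⟩⟩ := p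
    simp [borderedMatrix]
    rfl

end RamifiedConj

section ZModTwo

theorem ZMod.mul_self_mod_two (a : ZMod 2) : a * a = a := by revert a; decide

theorem ZMod.dotProduct_self_mod_two {ι : Type*} [Fintype ι] (v : ι → ZMod 2) :
    v ⬝ᵥ v = ∑ i, v i :=
  Finset.sum_congr rfl fun _ _ => ZMod.mul_self_mod_two _

/-- Any vector of odd weight other than the all-ones vector is the first row of an orthogonal
matrix over `𝔽₂`. -/
theorem exists_orthogonal_row {m : ℕ} (v : Fin (m + 1) → ZMod 2) (hv : ∑ i, v i = 1)
    (hne : v ≠ 1) : ∃ A : Matrix (Fin (m + 1)) (Fin (m + 1)) (ZMod 2), A * Aᵀ = 1 ∧ A 0 = v := by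
  obtain ⟨j, hj⟩ : ∃ j, v j = 0 := by
    by_contra! hcon
    refine hne (funext fun i => ?_)
    have := hcon i
    rw [Pi.one_apply]
    generalize v i = x at *
    revert x; decide
  have h2 : (2 : ZMod 2) = 0 := rfl
  let u : Fin (m + 1) → ZMod 2 := v + Pi.single j 1
  have huu : u ⬝ᵥ u = 0 := by
    rw [ZMod.dotProduct_self_mod_two]
    simp [u, Finset.sum_add_distrib, hv]
    rfl
  have hT : (1 + vecMulVec u u) * (1 + vecMulVec u u)ᵀ = 1 := by
    rw [transpose_add, transpose_one, transpose_vecMulVec, mul_add, add_mul, add_mul,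
      vecMulVec_mul_vecMulVec, huu]
    simp only [mul_one, one_mul, zero_smul, vecMulVec_zero, add_zero]
    rw [add_assoc, ← two_smul (ZMod 2) (vecMulVec u u), h2, zero_smul, add_zero]
  refine ⟨(1 + vecMulVec u u).submatrix (Equiv.swap 0 j) id, ?_, ?_⟩
  · rw [transpose_submatrix, ← submatrix_mul _ _ _ id _ Function.bijective_id, hT,
      submatrix_one_equiv]
  · ext i
    simp [u, vecMulVec_apply, hj, Matrix.one_apply, Pi.single_apply, eq_comm]
    split_ifs <;> generalize v i = x <;> revert x <;> decide

theorem sum_orthogonal_row {m : ℕ} {A : Matrix (Fin m) (Fin m) (ZMod 2)} (hA : A * Aᵀ = 1)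
    (i : Fin m) :
    ∑ j, A i j = 1 := by
  rw [← ZMod.dotProduct_self_mod_two]
  exact (congrFun (congrFun hA i) i).trans (Matrix.one_apply_eq i)

theorem first_row_ne_one {m : ℕ} {A : Matrix (Fin (m + 2)) (Fin (m + 2)) (ZMod 2)}
    (hA : A * Aᵀ = 1) : A 0 ≠ 1 := fun h0 => by
  have h1 := sum_orthogonal_row hA 1
  have h01 := congrFun (congrFun hA 0) 1
  simp [Matrix.mul_apply, h0, h1] at h01

/-- The stabilizer of the first basis vector. -/
theorem card_orthogonal_stabilizer (m : ℕ) :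
    Nat.card {A : Matrix (Fin (m + 1)) (Fin (m + 1)) (ZMod 2) //
      A * Aᵀ = 1 ∧ A 0 = Pi.single 0 1} =
      Nat.card {B : Matrix (Fin m) (Fin m) (ZMod 2) // B * Bᵀ = 1} := by
  have col : ∀ {A : Matrix (Fin (m + 1)) (Fin (m + 1)) (ZMod 2)},
      A * Aᵀ = 1 → A 0 = Pi.single 0 1 → ∀ i : Fin m, A i.succ 0 = 0 := fun {A} hA h0 i => by
    have := congrFun (congrFun hA i.succ) 0
    simpa [Matrix.mul_apply, h0, Pi.single_apply] using this
  refine Nat.card_congr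
    { toFun := fun A => ⟨A.1.submatrix Fin.succ Fin.succ, ?_⟩
      invFun := fun B => ⟨Matrix.of (Fin.cons (Pi.single 0 1) fun i => Fin.cons 0 (B.1 i)), ?_, ?_⟩
      left_inv := fun A => ?_
      right_inv := fun B => ?_ }
  · ext i j
    have := congrFun (congrFun A.2.1 i.succ) j.succ
    simpa [Matrix.mul_apply, Fin.sum_univ_succ, col A.2.1 A.2.2, Matrix.one_apply] using this
  · ext i j
    have hB := fun i j => congrFun (congrFun B.2 i) j
    simp only [Matrix.mul_apply, transpose_apply, Matrix.one_apply] at hB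
    refine Fin.cases (Fin.cases ?_ (fun j => ?_) j) (fun i => Fin.cases ?_ (fun j => ?_) j) i <;>
      simp [Matrix.mul_apply, Fin.sum_univ_succ, hB, Matrix.one_apply, (Fin.succ_ne_zero _).symm]
  · rfl
  · ext i j
    refine Fin.cases (Fin.cases ?_ (fun j => ?_) j) (fun i => Fin.cases ?_ (fun j => ?_) j) i <;>
      simp [A.2.2, col A.2.1 A.2.2]
  · rfl

theorem card_orthogonal_succ_s10 (m : ℕ) :
    Nat.card {A : Matrix (Fin (m + 2)) (Fin (m + 2)) (ZMod 2) // A * Aᵀ = 1} =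
      Nat.card {v : Fin (m + 2) → ZMod 2 // ∑ i, v i = 1 ∧ v ≠ 1} *
        Nat.card {B : Matrix (Fin (m + 1)) (Fin (m + 1)) (ZMod 2) // B * Bᵀ = 1} := by
  let f : {A : Matrix (Fin (m + 2)) (Fin (m + 2)) (ZMod 2) // A * Aᵀ = 1} →
      {v : Fin (m + 2) → ZMod 2 // ∑ i, v i = 1 ∧ v ≠ 1} := fun A =>
    ⟨A.1 0, sum_orthogonal_row A.2 0, first_row_ne_one A.2⟩
  refine Nat.card_eq_mul_of_card_fiber f _ fun ⟨v, hv, hv1⟩ => ?_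
  rw [← card_orthogonal_stabilizer]
  obtain ⟨A₀, hA₀, rfl⟩ := exists_orthogonal_row v hv hv1
  have hA₀' : A₀ᵀ * A₀ = 1 := mul_eq_one_comm.1 hA₀
  refine Nat.card_congr
    { toFun := fun A => ⟨A.1.1 * A₀ᵀ, ?_, ?_⟩
      invFun := fun B => ⟨⟨B.1 * A₀, ?_⟩, ?_⟩
      left_inv := fun A => ?_
      right_inv := fun B => ?_ }
  · rw [transpose_mul, transpose_transpose, Matrix.mul_assoc, ← Matrix.mul_assoc A₀ᵀ, hA₀', one_mul,
      A.1.2]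
  · have hA : A.1.1 0 = A₀ 0 := congrArg Subtype.val A.2
    ext j
    have := congrFun (congrFun hA₀ 0) j
    simp only [Matrix.mul_apply, hA] at this ⊢
    rw [this]
    simp [Matrix.one_apply, Pi.single_apply, eq_comm]
  · rw [transpose_mul, Matrix.mul_assoc, ← Matrix.mul_assoc A₀, hA₀, one_mul, B.2.1]
  · refine Subtype.ext (funext fun j => ?_)
    simp [f, Matrix.mul_apply, B.2.2, Pi.single_apply]
  · ext1; ext1; simp [Matrix.mul_assoc, hA₀']
  · ext1; simp [Matrix.mul_assoc, hA₀]

theorem card_orthogonal_one :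
    Nat.card {A : Matrix (Fin 1) (Fin 1) (ZMod 2) // A * Aᵀ = 1} = 1 := by
  rw [Nat.card_eq_one_iff_unique]
  refine ⟨⟨fun A B => ?_⟩, ⟨⟨1, by simp⟩⟩⟩
  have hA := sum_orthogonal_row A.2 0
  have hB := sum_orthogonal_row B.2 0
  ext i j
  fin_cases i; fin_cases j
  simpa using hA.trans hB.symm

theorem card_sum_eq_one (m : ℕ) :
    Nat.card {v : Fin (m + 1) → ZMod 2 // ∑ i, v i = 1} = 2 ^ m := by
  rw [Nat.card_congr (β := Fin m → ZMod 2)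
    { toFun := fun v i => v.1 i.succ
      invFun := fun w => ⟨Fin.cons (1 - ∑ i, w i) w, by simp [Fin.sum_univ_succ]⟩
      left_inv := fun v => ?_
      right_inv := fun w => rfl }]
  · simp
  · have := v.2
    rw [Fin.sum_univ_succ] at this
    ext i
    refine Fin.cases ?_ (fun i => ?_) i
    · simp [← this]
    · simp

theorem card_odd_vectors (m : ℕ) :
    (Nat.card {v : Fin (m + 1) → ZMod 2 // ∑ i, v i = 1 ∧ v ≠ 1} : ℚ) =
      2 ^ m - if Even m then 1 else 0 := by
  classical
  have hS : Nat.card {v : Fin (m + 1) → ZMod 2 // ∑ i, v i = 1 ∧ v ≠ 1} =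
      ((Finset.univ.filter fun v : Fin (m + 1) → ZMod 2 => ∑ i, v i = 1).erase 1).card := by
    rw [Nat.card_eq_fintype_card, Fintype.card_subtype]
    congr 1; ext v; simp [and_comm]
  have hT := card_sum_eq_one m
  rw [Nat.card_eq_fintype_card, Fintype.card_subtype] at hT
  have hmem : (1 : Fin (m + 1) → ZMod 2) ∈
      (Finset.univ.filter fun v : Fin (m + 1) → ZMod 2 => ∑ i, v i = 1) ↔ Even m := by
    simp [ZMod.natCast_eq_zero_iff_even]
  rw [hS]
  split_ifs with he
  · rw [Finset.cast_card_erase_of_mem (hmem.2 he), hT]; simp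
  · rw [Finset.erase_eq_of_notMem (mt hmem.1 he), hT]; simp

end ZModTwo

theorem RamifiedConj.card_orthogonal_mul {R : Type*} [CommRing R] {σ : R →+* R} {ρ : R →+* ZMod 2}
    (h : RamifiedConj σ ρ) (m : ℕ) :
    (Nat.card {A : Matrix (Fin (m + 1)) (Fin (m + 1)) (ZMod 2) // A * Aᵀ = 1} : ℚ) *
        2 ^ (2 * (m + 1) ^ 2) =
      Nat.card {H : Matrix (Fin (m + 1)) (Fin (m + 1)) R // IsUnitHermitian σ ρ H} *
        ∏ i ∈ Finset.Icc 1 (m / 2), (1 - (2 : ℚ) ^ (-(2 * (i : ℤ)))) := by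
  induction m with
  | zero =>
    rw [card_orthogonal_one, h.card_isUnitHermitian_succ, card_isUnitHermitian_zero]
    norm_num
  | succ m ih =>
    rw [card_orthogonal_succ_s10, h.card_isUnitHermitian_succ]
    push_cast
    rw [card_odd_vectors]
    have hpow : (2 : ℚ) ^ (2 * (m + 1 + 1) ^ 2) = 2 ^ (2 * (m + 1) ^ 2) * 2 ^ (4 * m + 6) := by
      rw [← pow_add]; congr 1; ring
    have hprod : (∏ i ∈ Finset.Icc 1 ((m + 1) / 2), (1 - (2 : ℚ) ^ (-(2 * (i : ℤ))))) =
        (∏ i ∈ Finset.Icc 1 (m / 2), (1 - (2 : ℚ) ^ (-(2 * (i : ℤ))))) *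
          (1 - if Even (m + 1) then ((2 : ℚ) ^ (m + 1))⁻¹ else 0) := by
      split_ifs with he
      · obtain ⟨k, hk⟩ := he
        rw [show (m + 1) / 2 = m / 2 + 1 by omega, Finset.prod_Icc_succ_top (by omega),
          show m / 2 + 1 = k by omega, hk]
        congr 2
        rw [_root_.zpow_neg, ← zpow_natCast]
        congr 2
        push_cast; ring
      · rw [Nat.not_even_iff_odd] at he
        obtain ⟨k, hk⟩ := he
        rw [show (m + 1) / 2 = m / 2 by omega]
        simp
    have hfac : ((2 : ℚ) ^ (m + 1) - if Even (m + 1) then 1 else 0) * 2 ^ (4 * m + 6) =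
        4 * 32 ^ (m + 1) * (1 - if Even (m + 1) then ((2 : ℚ) ^ (m + 1))⁻¹ else 0) := by
      have h32 : (32 : ℚ) ^ (m + 1) = 2 ^ (m + 1) * (2 ^ (m + 1)) ^ 4 := by
        rw [← pow_succ', ← pow_mul, mul_comm, pow_mul]; norm_num
      have h2 : (2 : ℚ) ^ (4 * m + 6) = 4 * (2 ^ (m + 1)) ^ 4 := by
        rw [← pow_mul, show (4 : ℚ) = 2 ^ 2 by norm_num, ← pow_add]; congr 1; ring
      have hne : (2 : ℚ) ^ (m + 1) ≠ 0 := by positivity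
      rw [h32, h2]
      split_ifs
      · field_simp
      · ring
    rw [hpow, hprod]
    linear_combination (((2 : ℚ) ^ (m + 1) - if Even (m + 1) then 1 else 0) * 2 ^ (4 * m + 6)) *
      ih +
      (Nat.card {H : Matrix (Fin (m + 1)) (Fin (m + 1)) R // IsUnitHermitian σ ρ H} : ℚ) *
        (∏ i ∈ Finset.Icc 1 (m / 2), (1 - (2 : ℚ) ^ (-(2 * (i : ℤ))))) * hfac

theorem RamifiedConj.card_special_unitary {R : Type*} [CommRing R] [Finite R] {σ : R →+* R}
    {ρ : R →+* ZMod 2} (h : RamifiedConj σ ρ) {m : ℕ} {δ : Fin (m + 1) → R}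
    (hδ : IsUnitHermitian σ ρ (diagonal δ)) :
    (Nat.card {A : Matrix (Fin (m + 1)) (Fin (m + 1)) R //
        A * diagonal δ * (A.map σ)ᵀ = diagonal δ ∧ A.det = 1} : ℚ) =
      2 ^ (3 * (m + 1) ^ 2 - 3) *
        ∏ i ∈ Finset.Icc 1 (m / 2), (1 - (2 : ℚ) ^ (-(2 * (i : ℤ)))) := by
  have hG := h.card_residually_orthogonal hδ rfl
  rw [h.card_lift_orthogonal, h.card_unitary_eq δ (h.isUnit_iff.2 hδ.residue_det)] at hG
  have hY := h.card_isUnitHermitian_eq_two_mul hδ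
  have hO := h.card_orthogonal_mul m
  have hY0 : (Nat.card {H : Matrix (Fin (m + 1)) (Fin (m + 1)) R // IsUnitHermitian σ ρ H} : ℚ)
      ≠ 0 := by
    have : Nonempty {H : Matrix (Fin (m + 1)) (Fin (m + 1)) R // IsUnitHermitian σ ρ H} :=
      ⟨⟨_, hδ⟩⟩
    exact_mod_cast Nat.card_pos.ne'
  have hGq := congrArg (Nat.cast : ℕ → ℚ) hG
  have hYq := congrArg (Nat.cast : ℕ → ℚ) hY
  push_cast at hGq hYq
  have h32 : (32 : ℚ) ^ (m + 1) ^ 2 =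
      2 ^ (2 * (m + 1) ^ 2) * (2 ^ (3 * (m + 1) ^ 2 - 3) * 8) := by
    have : 1 ≤ (m + 1) ^ 2 := Nat.one_le_pow _ _ (by omega)
    rw [show (32 : ℚ) = 2 ^ 5 by norm_num, show (8 : ℚ) = 2 ^ 3 by norm_num, ← pow_mul, ← pow_add,
      ← pow_add]
    congr 1; omega
  rw [h32] at hGq
  refine mul_left_cancel₀ hY0 (mul_left_cancel₀ (show (8 : ℚ) ≠ 0 by norm_num) ?_)
  linear_combination 8 * (Nat.card {A : Matrix (Fin (m + 1)) (Fin (m + 1)) R //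
    A * diagonal δ * (A.map σ)ᵀ = diagonal δ ∧ A.det = 1} : ℚ) * hYq - hGq +
    2 ^ (3 * (m + 1) ^ 2 - 3) * 8 * hO

namespace QuadraticAlgebra

/-- The residue map `x + y ω ↦ x + y mod 2`, where `ω ^ 2 = a` is odd. -/
def residueModTwo (a : ZMod 8) (ha : ZMod.castHom (by decide : 2 ∣ 8) (ZMod 2) a = 1) :
    QuadraticAlgebra (ZMod 8) a 0 →+* ZMod 2 where
  toFun z := ZMod.castHom (by decide : 2 ∣ 8) (ZMod 2) (z.re + z.im)
  map_one' := by simp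
  map_zero' := by simp
  map_add' z w := by simp only [re_add, im_add, map_add]; ring
  map_mul' z w := by
    simp only [re_mul, im_mul, map_add, map_mul, map_zero, ha]
    ring

theorem residueModTwo_apply (a : ZMod 8) (ha) (z : QuadraticAlgebra (ZMod 8) a 0) :
    residueModTwo a ha z = ZMod.castHom (by decide : 2 ∣ 8) (ZMod 2) (z.re + z.im) := rfl

instance (a : ZMod 8) : Fintype (QuadraticAlgebra (ZMod 8) a 0) :=
  Fintype.ofEquiv _ (equivProd a 0).symm

theorem ramifiedConj {a : ZMod 8} (ha : a = 3 ∨ a = 7)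
    (hodd : ZMod.castHom (by decide : 2 ∣ 8) (ZMod 2) a = 1) :
    RamifiedConj (starRingEnd (QuadraticAlgebra (ZMod 8) a 0)) (residueModTwo a hodd) := by
  have hcount : ∀ p : QuadraticAlgebra (ZMod 8) a 0 → Prop, [DecidablePred p] →
      Nat.card {r // p r} = (Finset.univ.filter fun q : ZMod 8 × ZMod 8 => p ⟨q.1, q.2⟩).card :=
    fun p _ => by
      rw [← Fintype.card_subtype, ← Nat.card_eq_fintype_card]
      exact Nat.card_congr ((equivProd a 0).subtypeEquiv fun _ => Iff.rfl)
  refine ⟨fun r => star_star r, ?_, ?_, ?_, ?_, ?_, ?_, ?_, ?_, ?_⟩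
  · simp only [residueModTwo_apply]
    rcases ha with rfl | rfl <;> rintro ⟨x, y⟩ <;> revert x y <;> decide
  · rintro ⟨x, y⟩
    obtain ⟨k, hk⟩ := ZMod.intCast_surjective (x * x - a * y * y)
    refine ⟨k, ?_⟩
    ext <;> simp [hk, starRingEnd_apply, star] <;> ring
  · simp only [residueModTwo_apply]
    rcases ha with rfl | rfl <;> rintro ⟨x, y⟩ <;> revert x y <;> decide
  · rcases ha with rfl | rfl <;> decide
  · rcases ha with rfl | rfl <;> decide
  · intro z
    simp only [residueModTwo_apply]
    rw [hcount]
    rcases ha with rfl | rfl <;> revert z <;> decide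
  · rw [hcount]
    rcases ha with rfl | rfl <;> decide
  · rcases ha with rfl | rfl
    · exact ⟨⟨0, 1⟩, by decide⟩
    · exact ⟨⟨1, 2⟩, by decide⟩
  · rcases ha with rfl | rfl
    · exact ⟨⟨1, 1⟩, ⟨1, 0⟩, by decide⟩
    · exact ⟨⟨2, 1⟩, ⟨1, 1⟩, by decide⟩

end QuadraticAlgebra

/-- Reduction modulo `m` of the quadratic integers, `x + y √a ↦ x + y ω`. -/
def Zsqrtd.toQuadraticAlgebra (a : ℤ) (m : ℕ) : ℤ√a →+* QuadraticAlgebra (ZMod m) a 0 where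
  toFun z := ⟨z.re, z.im⟩
  map_one' := by ext <;> simp <;> rfl
  map_zero' := by ext <;> simp
  map_add' z w := by ext <;> simp
  map_mul' z w := by ext <;> simp [mul_assoc]

theorem Zsqrtd.toQuadraticAlgebra_surjective (a : ℤ) (m : ℕ) :
    Function.Surjective (toQuadraticAlgebra a m) := by
  rintro ⟨x, y⟩
  obtain ⟨x, rfl⟩ := ZMod.intCast_surjective x
  obtain ⟨y, rfl⟩ := ZMod.intCast_surjective y
  exact ⟨⟨x, y⟩, rfl⟩

theorem Zsqrtd.ker_toQuadraticAlgebra (a : ℤ) (m : ℕ) :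
    RingHom.ker (toQuadraticAlgebra a m) = Ideal.span {((m : ℤ) : ℤ√a)} := by
  ext z
  rw [RingHom.mem_ker, Ideal.mem_span_singleton, Zsqrtd.intCast_dvd,
    ← ZMod.intCast_zmod_eq_zero_iff_dvd, ← ZMod.intCast_zmod_eq_zero_iff_dvd]
  exact QuadraticAlgebra.ext_iff

theorem Zsqrtd.toQuadraticAlgebra_star (a : ℤ) (m : ℕ) (z : ℤ√a) :
    toQuadraticAlgebra a m (star z) = star (toQuadraticAlgebra a m z) := by
  ext <;> simp [toQuadraticAlgebra]

/-- The ring `ℤ[√-d]/(m)` as a quadratic algebra over `ℤ/m`. -/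
noncomputable def equivQuadraticAlgebra (d : ℤ) (m : ℕ) :
    Rq d m ≃+* QuadraticAlgebra (ZMod m) (-d : ℤ) 0 :=
  (Ideal.quotEquivOfEq (Zsqrtd.ker_toQuadraticAlgebra (-d) m).symm).trans
    (RingHom.quotientKerEquivOfSurjective (Zsqrtd.toQuadraticAlgebra_surjective (-d) m))

theorem equivQuadraticAlgebra_conjQ (d : ℤ) (m : ℕ) (r : Rq d m) :
    equivQuadraticAlgebra d m (conjQ d m r) =
      starRingEnd (QuadraticAlgebra (ZMod m) (-d : ℤ) 0) (equivQuadraticAlgebra d m r) := by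
  obtain ⟨z, rfl⟩ := Ideal.Quotient.mk_surjective r
  exact Zsqrtd.toQuadraticAlgebra_star (-d) m z

theorem Lmat_map {R S : Type*} [Ring R] [Ring S] (f : R →+* S) (n : ℕ) :
    (Lmat R n).map f = Lmat S n := by
  ext i j
  simp only [Lmat, map_apply, diagonal_apply]
  split_ifs <;> simp

theorem isUnitHermitian_Lmat {R : Type*} [CommRing R] {σ : R →+* R} {ρ : R →+* ZMod 2}
    (n : ℕ) : IsUnitHermitian σ ρ (Lmat R n) where
  diag i := by
    rw [Lmat, diagonal_apply_eq]
    split_ifs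
    · exact neg_mem (one_mem _)
    · exact one_mem _
  conj i j := by
    simp only [Lmat, diagonal_apply]
    split_ifs <;> simp_all
  residue i j := by
    simp only [Lmat, diagonal_apply, one_apply]
    split_ifs <;> simp

theorem card_special_unitary_congr {R S ι : Type*} [CommRing R] [CommRing S] [Fintype ι]
    [DecidableEq ι] {σ : R →+* R} {τ : S →+* S} (e : R ≃+* S) (he : ∀ r, e (σ r) = τ (e r))
    (H : Matrix ι ι R) :
    Nat.card {A : Matrix ι ι R // A * H * (A.map σ)ᵀ = H ∧ A.det = 1} =
      Nat.card {A : Matrix ι ι S //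
        A * H.map e * (A.map τ)ᵀ = H.map e ∧ A.det = 1} := by
  refine Nat.card_congr (e.mapMatrix.toEquiv.subtypeEquiv fun A => and_congr ?_ ?_)
  · have hσ : ((A.map e).map τ)ᵀ = ((A.map σ)ᵀ).map e := by
      ext i j
      simp [he]
    change _ ↔ A.map e * H.map e * ((A.map e).map τ)ᵀ = H.map e
    rw [hσ, ← Matrix.map_mul, ← Matrix.map_mul]
    exact e.mapMatrix.injective.eq_iff.symm
  · change _ ↔ (e.mapMatrix A).det = 1
    rw [← e.map_det, EmbeddingLike.map_eq_one_iff]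

/-- For `d ≡ 1 (mod 4)`, the order of `SU(L, ℤ[√-d]/(8))` equals
`2^{3(n+1)²-3} · ∏_{i=1}^{⌊n/2⌋} (1 - 2^{-2i})`. -/
theorem card_SU_L_mod_eight (d : ℤ) (hd : 0 < d) (hsf : Squarefree d) (hd4 : d % 4 = 1)
    (n : ℕ) (hn : 1 ≤ n) :
    (Nat.card {A : Matrix (Fin (n + 1)) (Fin (n + 1)) (Rq d 8) //
        A * Lmat (Rq d 8) n * (A.map (conjQ d 8))ᵀ = Lmat (Rq d 8) n ∧
        A.det = 1} : ℚ)
      = 2 ^ (3 * (n + 1) ^ 2 - 3) *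
        ∏ i ∈ Finset.Icc 1 (n / 2), (1 - (2 : ℚ) ^ (-(2 * (i : ℤ)))) := by
  have ha : ((-d : ℤ) : ZMod 8) = 3 ∨ ((-d : ℤ) : ZMod 8) = 7 := by
    have h3 := ZMod.intCast_eq_intCast_iff' (-d) 3 8
    have h7 := ZMod.intCast_eq_intCast_iff' (-d) 7 8
    push_cast at h3 h7 ⊢
    rw [h3, h7]
    omega
  have hodd : ZMod.castHom (by decide : 2 ∣ 8) (ZMod 2) ((-d : ℤ) : ZMod 8) = 1 := by
    rcases ha with ha | ha <;> rw [ha] <;> rfl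
  have hL : (Lmat (Rq d 8) n).map (equivQuadraticAlgebra d 8) = Lmat _ n :=
    Lmat_map (equivQuadraticAlgebra d 8).toRingHom n
  rw [← (QuadraticAlgebra.ramifiedConj ha hodd).card_special_unitary
    (isUnitHermitian_Lmat n)]
  exact congrArg Nat.cast ((card_special_unitary_congr (equivQuadraticAlgebra d 8)
    (equivQuadraticAlgebra_conjQ d 8) _).trans (by rw [hL]; rfl))
end
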